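/- Let (X,d,m) be a length PI space having the deformation property, let E ⊆ X be a volume-constrained minimizer of the perimeter, and fix x ∈ E^(0) and y ∈ E^(1). Define v(r) := m(B_r(x) ∩ E) and w(r) := m(B_r(y) \ E) for r > 0, fix a sequence (r_n) ⊆ (0,1) with r_n → 0, and for each n set A_n := {r ∈ (0,r_n) : v(r) ≥ w(r)}. Assume: (i) there exists δ ∈ (0, R_y(E)) such that the closed balls of radius δ centered at x and at y are disjoint, v(δ) > 0 and w(δ) > 0; (ii) the Lebesgue measure of A_n is at least r_n/2 for infinitely many n. Then x belongs to the topological interior of E^(0). -/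

import Mathlib

open MeasureTheory Metric Set Filter Topology ENNReal Bornology
open scoped symmDiff

noncomputable section

variable {X : Type*}

/-- The slope (pointwise Lipschitz constant) of `f` at `x`, computed within `Ω`.
It vanishes at points that are isolated in `Ω`. -/
def slopeOn [MetricSpace X] (Ω : Set X) (f : X → ℝ) (x : X) : ℝ≥0∞ :=
  Filter.limsup (fun y => ENNReal.ofReal (|f x - f y| / dist x y)) (𝓝[Ω \ {x}] x)

/-- The slope of `f`. -/
def mSlope [MetricSpace X] (f : X → ℝ) (x : X) : ℝ≥0∞ := slopeOn Set.univ f x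

/-- `f` is locally Lipschitz on `Ω`. -/
def LocLipOn [MetricSpace X] (Ω : Set X) (f : X → ℝ) : Prop :=
  ∀ x ∈ Ω, ∃ r > (0:ℝ), ∃ K : NNReal, LipschitzOnWith K f (Metric.ball x r ∩ Ω)

/-- Convergence `fn → f` in `L¹_loc(Ω)` w.r.t. the measure `m`. -/
def TendstoL1loc [MetricSpace X] [MeasurableSpace X] (m : Measure X) (Ω : Set X)
    (fn : ℕ → X → ℝ) (f : X → ℝ) : Prop :=
  ∀ K : Set X, K ⊆ Ω → IsCompact K →
    Tendsto (fun n => ∫⁻ x in K, ENNReal.ofReal |fn n x - f x| ∂m) atTop (𝓝 0)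

/-- The total variation `|Df|(B)` of `f : X → ℝ` on the set `B`. -/
def totVar [MetricSpace X] [MeasurableSpace X] (m : Measure X) (f : X → ℝ) (B : Set X) : ℝ≥0∞ :=
  ⨅ (Ω : Set X) (_ : IsOpen Ω) (_ : B ⊆ Ω),
    ⨅ (fn : ℕ → X → ℝ) (_ : ∀ n, LocLipOn Ω (fn n)) (_ : TendstoL1loc m Ω fn f),
      Filter.liminf (fun n => ∫⁻ x in Ω, slopeOn Ω (fn n) x ∂m) atTop

/-- The perimeter `P(E, B)` of a set `E` in `B`. -/
def Per [MetricSpace X] [MeasurableSpace X] (m : Measure X) (E B : Set X) : ℝ≥0∞ :=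
  totVar m (Set.indicator E fun _ => (1:ℝ)) B

/-- `E` has locally finite perimeter. -/
def HasLocFinPer [MetricSpace X] [MeasurableSpace X] (m : Measure X) (E : Set X) : Prop :=
  ∀ x : X, ∃ r > (0:ℝ), Per m E (Metric.ball x r) < ∞

/-- `E` has finite perimeter. -/
def HasFinPer [MetricSpace X] [MeasurableSpace X] (m : Measure X) (E : Set X) : Prop :=
  Per m E Set.univ < ∞

/-- `m` is finite on bounded sets. -/
def BoundedlyFinite [MetricSpace X] [MeasurableSpace X] (m : Measure X) : Prop :=
  ∀ B : Set X, Bornology.IsBounded B → m B < ∞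

/-- Uniformly locally doubling with doubling function `C_D`. -/
def UnifLocDoublingWith [MetricSpace X] [MeasurableSpace X] (C_D : ℝ → ℝ) (m : Measure X) : Prop :=
  ∀ R : ℝ, 0 < R → ∀ x : X, ∀ r : ℝ, 0 < r → r < R →
    m (Metric.ball x (2 * r)) ≤ ENNReal.ofReal (C_D R) * m (Metric.ball x r)

/-- Weak local (1,1)-Poincaré inequality with dilation `lam` and constant function `C_P`. -/
def WeakPoincareWith [MetricSpace X] [MeasurableSpace X] (lam : ℝ) (C_P : ℝ → ℝ)
    (m : Measure X) : Prop :=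
  ∀ f : X → ℝ, LocLipOn Set.univ f → ∀ R : ℝ, 0 < R → ∀ x : X, ∀ r : ℝ, 0 < r → r < R →
    (∫⁻ y in Metric.ball x r,
        ENNReal.ofReal |f y - ⨍ z in Metric.ball x r, f z ∂m| ∂m) / m (Metric.ball x r)
      ≤ ENNReal.ofReal (C_P R * r) *
          ((∫⁻ y in Metric.ball x (lam * r), mSlope f y ∂m) / m (Metric.ball x (lam * r)))

/-- `(X, d, m)` is a PI space. -/
def IsPIspace [MetricSpace X] [MeasurableSpace X] (m : Measure X) : Prop :=
  (∃ C_D : ℝ → ℝ, (∀ R, 0 < R → 0 < C_D R) ∧ UnifLocDoublingWith C_D m) ∧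
  (∃ lam : ℝ, 1 ≤ lam ∧ ∃ C_P : ℝ → ℝ, (∀ R, 0 < R → 0 < C_P R) ∧ WeakPoincareWith lam C_P m)

/-- `(X, d)` is a length space: the distance between two points is the infimum of the
lengths of continuous curves joining them. -/
def IsLengthSpace (X : Type*) [MetricSpace X] : Prop :=
  ∀ p q : X, ENNReal.ofReal (dist p q) =
    ⨅ (γ : ℝ → X) (_ : ContinuousOn γ (Set.Icc 0 1)) (_ : γ 0 = p) (_ : γ 1 = q),
      eVariationOn γ (Set.Icc 0 1)

/-- Essential interior `E^{(1)}`. -/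
def essInt [MetricSpace X] [MeasurableSpace X] (m : Measure X) (E : Set X) : Set X :=
  { x | Tendsto (fun r : ℝ => m (E ∩ Metric.ball x r) / m (Metric.ball x r)) (𝓝[>] 0) (𝓝 1) }

/-- Essential exterior `E^{(0)}`. -/
def essExt [MetricSpace X] [MeasurableSpace X] (m : Measure X) (E : Set X) : Set X :=
  { x | Tendsto (fun r : ℝ => m (E ∩ Metric.ball x r) / m (Metric.ball x r)) (𝓝[>] 0) (𝓝 0) }

/-- Essential boundary `∂^e E`. -/
def essBdry [MetricSpace X] [MeasurableSpace X] (m : Measure X) (E : Set X) : Set X :=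
  (essInt m E ∪ essExt m E)ᶜ

/-- The two deformation inequalities hold for `E` at `x` with radius `R` and constant `C`. -/
def DeformIneq [MetricSpace X] [MeasurableSpace X] (m : Measure X) (E : Set X) (x : X)
    (R C : ℝ) : Prop :=
  ∀ y ∈ Metric.ball x R, ∀ r ∈ Set.Ioo (0:ℝ) R,
    Per m (E \ Metric.ball y r) (Metric.ball x (2 * R)) ≤
      ENNReal.ofReal C * m (Metric.ball y r ∩ E) / ENNReal.ofReal r +
        Per m E (Metric.ball x (2 * R)) ∧
    Per m (E ∪ Metric.ball y r) (Metric.ball x (2 * R)) ≤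
      ENNReal.ofReal C * m (Metric.ball y r \ E) / ENNReal.ofReal r +
        Per m E (Metric.ball x (2 * R))

/-- The deformation inequalities hold for `E` at `x` with radius `R` and some constant. -/
def DeformAt [MetricSpace X] [MeasurableSpace X] (m : Measure X) (E : Set X) (x : X)
    (R : ℝ) : Prop :=
  0 < R ∧ R ≤ 1 ∧ ∃ C : ℝ, 0 ≤ C ∧ DeformIneq m E x R C

/-- `R_x(E)`: the maximal radius in `(0,1]` for which the deformation inequalities hold. -/
def deformRadius [MetricSpace X] [MeasurableSpace X] (m : Measure X) (E : Set X) (x : X) : ℝ :=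
  sSup { R : ℝ | DeformAt m E x R }

/-- `(X, d, m)` has the deformation property. -/
def DeformationProperty [MetricSpace X] [MeasurableSpace X] (m : Measure X) : Prop :=
  ∀ E : Set X, MeasurableSet E → HasLocFinPer m E → ∀ x : X, ∃ R : ℝ, DeformAt m E x R

/-- `E` is a volume-constrained minimizer of the perimeter. -/
def VolConstMin [MetricSpace X] [MeasurableSpace X] (m : Measure X) (E : Set X) : Prop :=
  MeasurableSet E ∧ HasLocFinPer m E ∧
    ∀ F K : Set X, MeasurableSet F → IsCompact K →
      m ((E ∆ F) \ K) = 0 → m (E ∩ K) = m (F ∩ K) → Per m E K ≤ Per m F K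

/-- `E` is an isoperimetric set. -/
def IsIsoperimetricSet [MetricSpace X] [MeasurableSpace X] (m : Measure X) (E : Set X) : Prop :=
  MeasurableSet E ∧ HasFinPer m E ∧ 0 < m E ∧ m E < ∞ ∧
    ∀ F : Set X, MeasurableSet F → m F = m E → Per m E Set.univ ≤ Per m F Set.univ


section Slope

variable [MetricSpace X]

lemma slopeOn_eq_mSlope {Ω : Set X} (hΩ : IsOpen Ω) (f : X → ℝ) {p : X} (hp : p ∈ Ω) :
    slopeOn Ω f p = mSlope f p := by
  have h : 𝓝[Ω \ {p}] p = 𝓝[Set.univ \ {p}] p := by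
    refine nhdsWithin_eq_nhdsWithin' (hΩ.mem_nhds hp) ?_
    ext q
    simp +contextual
  simp only [slopeOn, mSlope, h]

lemma mSlope_congr {f g : X → ℝ} {p : X} (h : f =ᶠ[𝓝 p] g) : mSlope f p = mSlope g p := by
  refine Filter.limsup_congr ?_
  have h' : ∀ᶠ q in 𝓝[Set.univ \ {p}] p, f q = g q := nhdsWithin_le_nhds h
  filter_upwards [h'] with q hq
  rw [hq, h.eq_of_nhds]

lemma locLipOn_iff {Ω : Set X} (hΩ : IsOpen Ω) {f : X → ℝ} :
    LocLipOn Ω f ↔ ∀ p ∈ Ω, ∃ K : NNReal, ∃ t ∈ 𝓝 p, LipschitzOnWith K f t := by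
  refine forall₂_congr fun p hp => ?_
  constructor
  · rintro ⟨r, hr, K, hK⟩
    exact ⟨K, _, inter_mem (Metric.ball_mem_nhds p hr) (hΩ.mem_nhds hp), hK⟩
  · rintro ⟨K, t, ht, hK⟩
    obtain ⟨r, hr, hrt⟩ := Metric.mem_nhds_iff.1 ht
    exact ⟨r, hr, K, hK.mono (Set.inter_subset_left.trans hrt)⟩

lemma LocLipOn.mono {Ω U : Set X} (hΩ : IsOpen Ω) (hU : IsOpen U) {f : X → ℝ}
    (hf : LocLipOn Ω f) (h : U ⊆ Ω) : LocLipOn U f :=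
  (locLipOn_iff hU).2 fun p hp => (locLipOn_iff hΩ).1 hf p (h hp)

lemma LocLipOn.continuousOn {Ω : Set X} (hΩ : IsOpen Ω) {f : X → ℝ} (hf : LocLipOn Ω f) :
    ContinuousOn f Ω := by
  intro p hp
  obtain ⟨K, t, ht, hK⟩ := (locLipOn_iff hΩ).1 hf p hp
  exact (hK.continuousOn.continuousAt ht).continuousWithinAt

lemma aemeasurable_mSlope [MeasurableSpace X] [BorelSpace X] (m : Measure X) {Ω : Set X}
    (hΩ : IsOpen Ω) {f : X → ℝ} (hf : ContinuousOn f Ω) :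
    AEMeasurable (mSlope f) (m.restrict Ω) := by
  let s : ℕ → X → ℝ≥0∞ := fun n p =>
    ⨆ (q : X) (_ : p ∈ Ω ∧ q ≠ p ∧ dist q p < 1 / ((n : ℝ) + 1)),
      ENNReal.ofReal (|f p - f q| / dist p q)
  have hs : ∀ n, Measurable (s n) := by
    intro n
    refine measurable_of_Ioi fun c => IsOpen.measurableSet ?_
    have : s n ⁻¹' Ioi c = ⋃ q : X, (Ω ∩ {p | p ≠ q} ∩ {p | dist q p < 1 / ((n : ℝ) + 1)}) ∩
        (fun p => ENNReal.ofReal (|f p - f q| / dist p q)) ⁻¹' Ioi c := by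
      ext p
      simp only [s, mem_preimage, mem_Ioi, lt_iSup_iff, mem_iUnion, mem_inter_iff, mem_ofPred_eq,
        exists_prop, ne_comm (a := p)]
      exact exists_congr fun q => by tauto
    rw [this]
    refine isOpen_iUnion fun q => ?_
    have ho : IsOpen (Ω ∩ {p | p ≠ q} ∩ {p | dist q p < 1 / ((n : ℝ) + 1)}) :=
      (hΩ.inter isOpen_ne).inter (isOpen_lt (by fun_prop) continuous_const)
    refine ContinuousOn.isOpen_inter_preimage ?_ ho isOpen_Ioi
    refine ENNReal.continuous_ofReal.comp_continuousOn ?_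
    refine ContinuousOn.div ?_ (by fun_prop) fun p hp => dist_ne_zero.2 hp.1.2
    exact ((hf.mono fun p hp => hp.1.1).sub continuousOn_const).abs
  refine ⟨fun p => ⨅ n, s n p, Measurable.iInf hs, ?_⟩
  refine (ae_restrict_iff' hΩ.measurableSet).2 (Eventually.of_forall fun p hp => ?_)
  have hb : (𝓝[Set.univ \ {p}] p).HasBasis (fun _ : ℕ => True)
      fun n => ball p (1 / ((n : ℝ) + 1)) ∩ (Set.univ \ {p}) :=
    nhdsWithin_hasBasis Metric.nhds_basis_ball_inv_nat_succ _
  rw [mSlope, slopeOn, hb.limsup_eq_iInf_iSup]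
  simp only [s, iInf_true]
  refine iInf_congr fun n => iSup_congr fun q => ?_
  refine iSup_congr_Prop ?_ fun _ => rfl
  simp [hp, and_comm]

lemma mSlope_glue_le {a b φ : X → ℝ} {L : NNReal} (hφ : LipschitzWith L φ)
    (h01 : ∀ p, φ p ∈ Set.Icc (0 : ℝ) 1) {p : X} (ha : ContinuousAt a p) (hb : ContinuousAt b p) :
    mSlope (fun q => φ q * a q + (1 - φ q) * b q) p ≤
      mSlope a p + (mSlope b p + L * ENNReal.ofReal |a p - b p|) := by
  have hc : Tendsto (fun q => (L : ℝ≥0∞) * ENNReal.ofReal |a q - b q|) (𝓝[Set.univ \ {p}] p)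
      (𝓝 (L * ENNReal.ofReal |a p - b p|)) := by
    refine ENNReal.Tendsto.const_mul ?_ (Or.inr ENNReal.coe_ne_top)
    exact ENNReal.tendsto_ofReal ((ha.sub hb).abs.tendsto.mono_left nhdsWithin_le_nhds)
  refine ENNReal.le_of_forall_pos_le_add fun ε hε hfin => ?_
  have hε' : (0 : ℝ≥0∞) < ε / 3 := by simpa using hε.ne'
  obtain ⟨h1, h2⟩ := ENNReal.add_lt_top.1 hfin
  obtain ⟨h2, h3⟩ := ENNReal.add_lt_top.1 h2
  have e1 := Filter.eventually_lt_of_limsup_lt (ENNReal.lt_add_right h1.ne hε'.ne')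
  have e2 := Filter.eventually_lt_of_limsup_lt (ENNReal.lt_add_right h2.ne hε'.ne')
  have e3 := (hc.eventually_lt_const (ENNReal.lt_add_right h3.ne hε'.ne'))
  refine Filter.limsup_le_of_le (by isBoundedDefault) ?_
  filter_upwards [e1, e2, e3, self_mem_nhdsWithin] with q h1 h2 h3 hq
  have hd : 0 < dist p q := dist_pos.2 (Ne.symm hq.2)
  have key : |φ p * a p + (1 - φ p) * b p - (φ q * a q + (1 - φ q) * b q)| ≤
      |a p - a q| + (|b p - b q| + L * dist p q * |a q - b q|) := by
    have : φ p * a p + (1 - φ p) * b p - (φ q * a q + (1 - φ q) * b q) =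
        φ p * (a p - a q) + ((1 - φ p) * (b p - b q) + (φ p - φ q) * (a q - b q)) := by ring
    rw [this]
    obtain ⟨h0, h1⟩ := h01 p
    refine (abs_add_le _ _).trans (add_le_add ?_ ((abs_add_le _ _).trans (add_le_add ?_ ?_)))
    · rw [abs_mul, abs_of_nonneg h0]
      exact mul_le_of_le_one_left (abs_nonneg _) h1
    · rw [abs_mul, abs_of_nonneg (by linarith : 0 ≤ 1 - φ p)]
      exact mul_le_of_le_one_left (abs_nonneg _) (by linarith)
    · rw [abs_mul]
      exact mul_le_mul_of_nonneg_right (hφ.dist_le_mul p q) (abs_nonneg _)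
  calc ENNReal.ofReal (|φ p * a p + (1 - φ p) * b p - (φ q * a q + (1 - φ q) * b q)| / dist p q)
      ≤ ENNReal.ofReal (|a p - a q| / dist p q + (|b p - b q| / dist p q + L * |a q - b q|)) := by
        refine ENNReal.ofReal_le_ofReal ?_
        rw [div_le_iff₀ hd]
        refine key.trans (le_of_eq ?_)
        field_simp
    _ = ENNReal.ofReal (|a p - a q| / dist p q) + (ENNReal.ofReal (|b p - b q| / dist p q) +
          L * ENNReal.ofReal |a q - b q|) := by
        rw [ENNReal.ofReal_add (by positivity) (by positivity),
          ENNReal.ofReal_add (by positivity) (by positivity),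
          ENNReal.ofReal_mul (by positivity), ENNReal.ofReal_coe_nnreal]
    _ ≤ (mSlope a p + ε / 3) + ((mSlope b p + ε / 3) + (L * ENNReal.ofReal |a p - b p| + ε / 3)) :=
        add_le_add h1.le (add_le_add h2.le h3.le)
    _ = mSlope a p + (mSlope b p + L * ENNReal.ofReal |a p - b p|) + (ε / 3 + ε / 3 + ε / 3) := by
        ring
    _ = _ := by rw [ENNReal.add_thirds]

lemma LipschitzOnWith.exists_glue {a b φ : X → ℝ} {L Ka Kb : NNReal} (hφ : LipschitzWith L φ)
    (h01 : ∀ p, φ p ∈ Set.Icc (0 : ℝ) 1) {p : X} {s t : Set X} (hs : s ∈ 𝓝 p) (ht : t ∈ 𝓝 p)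
    (ha : LipschitzOnWith Ka a s) (hb : LipschitzOnWith Kb b t) :
    ∃ K : NNReal, ∃ u ∈ 𝓝 p, LipschitzOnWith K (fun q => φ q * a q + (1 - φ q) * b q) u := by
  have hab : ContinuousAt (fun q => |a q - b q|) p :=
    ((ha.continuousOn.continuousAt hs).sub (hb.continuousOn.continuousAt ht)).abs
  let M : NNReal := ⟨|a p - b p| + 1, by positivity⟩
  have hM : ∀ᶠ q in 𝓝 p, |a q - b q| < M := hab.eventually_lt_const (lt_add_one _)
  refine ⟨Ka + (Kb + L * M), _, inter_mem (inter_mem hs ht) hM,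
    LipschitzOnWith.of_dist_le_mul fun q hq q' hq' => ?_⟩
  have h1 := ha.dist_le_mul q hq.1.1 q' hq'.1.1
  have h2 := hb.dist_le_mul q hq.1.2 q' hq'.1.2
  have h3 := hφ.dist_le_mul q q'
  have h4 : |a q' - b q'| ≤ M := hq'.2.le
  rw [Real.dist_eq] at *
  have : φ q * a q + (1 - φ q) * b q - (φ q' * a q' + (1 - φ q') * b q') =
      φ q * (a q - a q') + ((1 - φ q) * (b q - b q') + (φ q - φ q') * (a q' - b q')) := by ring
  rw [this]
  obtain ⟨h0, h1'⟩ := h01 q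
  push_cast
  have e1 : |φ q * (a q - a q')| ≤ Ka * dist q q' := by
    rw [abs_mul, abs_of_nonneg h0]
    exact (mul_le_of_le_one_left (abs_nonneg _) h1').trans h1
  have e2 : |(1 - φ q) * (b q - b q')| ≤ Kb * dist q q' := by
    rw [abs_mul, abs_of_nonneg (by linarith : 0 ≤ 1 - φ q)]
    exact (mul_le_of_le_one_left (abs_nonneg _) (by linarith)).trans h2
  have e3 : |(φ q - φ q') * (a q' - b q')| ≤ L * dist q q' * M := by
    rw [abs_mul]
    exact mul_le_mul h3 h4 (abs_nonneg _) (by positivity)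
  have e4 := (abs_add_le (φ q * (a q - a q'))
    ((1 - φ q) * (b q - b q') + (φ q - φ q') * (a q' - b q')))
  have e5 := abs_add_le ((1 - φ q) * (b q - b q')) ((φ q - φ q') * (a q' - b q'))
  linarith

end Slope

section TotalVariation

variable [MetricSpace X] [MeasurableSpace X]

lemma totVar_mono (m : Measure X) (f : X → ℝ) {A B : Set X} (h : A ⊆ B) :
    totVar m f A ≤ totVar m f B :=
  le_iInf fun Ω => le_iInf fun hΩ => le_iInf fun hB =>
    (iInf_le _ Ω).trans ((iInf_le _ hΩ).trans (iInf_le _ (h.trans hB)))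

lemma exists_open_totVar_lt {m : Measure X} {f : X → ℝ} {B : Set X} {c : ℝ≥0∞}
    (h : totVar m f B < c) : ∃ Ω, IsOpen Ω ∧ B ⊆ Ω ∧ totVar m f Ω < c := by
  simp only [totVar, iInf_lt_iff] at h
  obtain ⟨Ω, hΩ, hB, fn, h1, h2, h3⟩ := h
  refine ⟨Ω, hΩ, hB, ?_⟩
  simp only [totVar, iInf_lt_iff]
  exact ⟨Ω, hΩ, Subset.rfl, fn, h1, h2, h3⟩

variable [BorelSpace X] {m : Measure X}

lemma exists_seq_of_totVar_lt {f : X → ℝ} {Ω : Set X} (hΩ : IsOpen Ω) {c : ℝ≥0∞}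
    (h : totVar m f Ω < c) : ∃ fn : ℕ → X → ℝ, (∀ n, LocLipOn Ω (fn n)) ∧
      TendstoL1loc m Ω fn f ∧ liminf (fun n => ∫⁻ p in Ω, mSlope (fn n) p ∂m) atTop < c := by
  simp only [totVar, iInf_lt_iff] at h
  obtain ⟨U, hU, hB, fn, h1, h2, h3⟩ := h
  refine ⟨fn, fun n => (h1 n).mono hU hΩ hB, fun K hK hKc => h2 K (hK.trans hB) hKc,
    lt_of_le_of_lt (liminf_le_liminf (Eventually.of_forall fun n => ?_)) h3⟩
  rw [setLIntegral_congr_fun hU.measurableSet fun p hp => slopeOn_eq_mSlope hU (fn n) hp]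
  exact lintegral_mono_set hB

lemma exists_approx_of_totVar_lt {f : X → ℝ} {Ω : Set X} (hΩ : IsOpen Ω) {c : ℝ≥0∞}
    (h : totVar m f Ω < c) {K : Set X} (hK : IsCompact K) (hKΩ : K ⊆ Ω) {ε : ℝ≥0∞} (hε : ε ≠ 0) :
    ∃ g, LocLipOn Ω g ∧ ∫⁻ p in K, ENNReal.ofReal |g p - f p| ∂m ≤ ε ∧
      ∫⁻ p in Ω, mSlope g p ∂m ≤ c := by
  obtain ⟨fn, h1, h2, h3⟩ := exists_seq_of_totVar_lt hΩ h
  have h4 := Filter.frequently_lt_of_liminf_lt (by isBoundedDefault) h3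
  have h5 := (h2 K hKΩ hK).eventually_lt_const (pos_iff_ne_zero.2 hε)
  obtain ⟨n, hn, hn'⟩ := (h4.and_eventually h5).exists
  exact ⟨fn n, h1 n, hn'.le, hn.le⟩

lemma totVar_le_of_approx [ProperSpace X] {f : X → ℝ} {Ω : Set X} (hΩ : IsOpen Ω) {c : ℝ≥0∞}
    (h : ∀ K, IsCompact K → K ⊆ Ω → ∀ ε : ℝ≥0∞, ε ≠ 0 →
      ∃ g, LocLipOn Ω g ∧ ∫⁻ p in K, ENNReal.ofReal |g p - f p| ∂m ≤ ε ∧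
        ∫⁻ p in Ω, mSlope g p ∂m ≤ c + ε) : totVar m f Ω ≤ c := by
  have := hΩ.locallyCompactSpace
  let Ke : CompactExhaustion Ω := default
  have hε : ∀ n : ℕ, ((n : ℝ≥0∞) + 1)⁻¹ ≠ 0 := fun n => by simp
  choose g h1 h2 h3 using fun n : ℕ => h (Subtype.val '' Ke n)
    ((Ke.isCompact n).image continuous_subtype_val) (by rintro _ ⟨p, -, rfl⟩; exact p.2) _ (hε n)
  have hlim : Tendsto (fun n : ℕ => ((n : ℝ≥0∞) + 1)⁻¹) atTop (𝓝 0) := by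
    have := (tendsto_add_atTop_iff_nat 1).2 ENNReal.tendsto_inv_nat_nhds_zero
    simpa using this
  have hL1 : TendstoL1loc m Ω g f := by
    intro K hK hKc
    have hK' : IsCompact ((↑) ⁻¹' K : Set Ω) :=
      Topology.IsInducing.subtypeVal.isCompact_preimage_iff (by simpa using hK) |>.2 hKc
    obtain ⟨N, hN⟩ := Ke.exists_superset_of_isCompact hK'
    refine tendsto_of_tendsto_of_tendsto_of_le_of_le' tendsto_const_nhds hlim
      (Eventually.of_forall fun _ => zero_le) ?_
    filter_upwards [eventually_ge_atTop N] with n hn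
    refine (lintegral_mono_set fun p hp => ?_).trans (h2 n)
    exact ⟨⟨p, hK hp⟩, Ke.subset hn (hN hp), rfl⟩
  refine (iInf₂_le Ω hΩ).trans ((iInf_le _ Subset.rfl).trans ((iInf₂_le g h1).trans
    ((iInf_le _ hL1).trans ?_)))
  have hlim' : Tendsto (fun n : ℕ => c + ((n : ℝ≥0∞) + 1)⁻¹) atTop (𝓝 c) := by
    simpa using tendsto_const_nhds.add hlim
  rw [← hlim'.liminf_eq]
  refine liminf_le_liminf (Eventually.of_forall fun n => ?_)
  rw [setLIntegral_congr_fun hΩ.measurableSet fun p hp => slopeOn_eq_mSlope hΩ (g n) hp]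
  exact h3 n

lemma totVar_congr [ProperSpace X] {f g : X → ℝ} {Ω : Set X} (hΩ : IsOpen Ω)
    (h : Set.EqOn f g Ω) : totVar m f Ω ≤ totVar m g Ω := by
  refine le_of_forall_gt fun c hc => ?_
  obtain ⟨c', hc', hc'c⟩ := exists_between hc
  refine lt_of_le_of_lt (totVar_le_of_approx hΩ fun K hK hKΩ ε hε => ?_) hc'c
  obtain ⟨a, h1, h2, h3⟩ := exists_approx_of_totVar_lt hΩ hc' hK hKΩ hε
  refine ⟨a, h1, ?_, h3.trans le_self_add⟩
  rw [setLIntegral_congr_fun hK.measurableSet fun p hp => by rw [h (hKΩ hp)]]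
  exact h2

lemma totVar_add_le_of_disjoint {f : X → ℝ} {U V W : Set X} (hU : IsOpen U) (hV : IsOpen V)
    (hW : IsOpen W) (hUW : U ⊆ W) (hVW : V ⊆ W) (hUV : Disjoint U V) :
    totVar m f U + totVar m f V ≤ totVar m f W := by
  refine le_of_forall_gt fun c hc => ?_
  obtain ⟨fn, h1, h2, h3⟩ := exists_seq_of_totVar_lt hW hc
  have key : ∀ A, IsOpen A → A ⊆ W →
      totVar m f A ≤ liminf (fun n => ∫⁻ p in A, mSlope (fn n) p ∂m) atTop := by
    intro A hA hAW
    refine (iInf₂_le A hA).trans ((iInf_le _ Subset.rfl).trans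
      ((iInf₂_le fn fun n => (h1 n).mono hW hA hAW).trans
      ((iInf_le _ fun K hK hKc => h2 K (hK.trans hAW) hKc).trans (le_of_eq ?_))))
    congr 1
    ext n
    exact setLIntegral_congr_fun hA.measurableSet fun p hp => slopeOn_eq_mSlope hA (fn n) hp
  refine lt_of_le_of_lt ((add_le_add (key U hU hUW) (key V hV hVW)).trans ?_) h3
  simp only [liminf_eq_iSup_iInf_of_nat]
  rw [ENNReal.iSup_add_iSup_of_monotone]
  · refine iSup_mono fun n => le_iInf₂ fun k hk => ?_
    refine (add_le_add (iInf₂_le k hk) (iInf₂_le k hk)).trans ?_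
    rw [← lintegral_union hV.measurableSet hUV]
    exact lintegral_mono_set (union_subset hUW hVW)
  · exact fun i j hij => le_iInf₂ fun k hk => iInf₂_le k (hij.trans hk)
  · exact fun i j hij => le_iInf₂ fun k hk => iInf₂_le k (hij.trans hk)

lemma totVar_le_of_lsc [ProperSpace X] {f : X → ℝ} (hf : Measurable f) {Ω : Set X}
    (hΩ : IsOpen Ω) {c : ℝ≥0∞}
    (h : ∀ K, IsCompact K → K ⊆ Ω → ∀ ε : ℝ≥0∞, ε ≠ 0 →
      ∃ g, Measurable g ∧ ∫⁻ p in K, ENNReal.ofReal |g p - f p| ∂m ≤ ε ∧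
        totVar m g Ω ≤ c + ε) : totVar m f Ω ≤ c := by
  rcases eq_or_ne c ∞ with rfl | hc
  · exact le_top
  refine totVar_le_of_approx hΩ fun K hK hKΩ ε hε => ?_
  rcases eq_or_ne ε ∞ with rfl | hεt
  · obtain ⟨g, h1, h2, h3⟩ := h K hK hKΩ 1 one_ne_zero
    obtain ⟨a, h1, h2, h3⟩ := exists_approx_of_totVar_lt hΩ
      (h3.trans_lt (ENNReal.add_lt_top.2 ⟨hc.lt_top, ENNReal.one_lt_top⟩)) hK hKΩ ENNReal.top_ne_zero
    exact ⟨a, h1, le_top, by simp⟩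
  have hε2 : ε / 2 ≠ 0 := by simpa using hε
  obtain ⟨g, hg, h2, h3⟩ := h K hK hKΩ _ hε2
  have h4 : c + ε / 2 < c + ε := ENNReal.add_lt_add_left hc (ENNReal.half_lt_self hε hεt)
  obtain ⟨a, h5, h6, h7⟩ := exists_approx_of_totVar_lt hΩ (h3.trans_lt h4) hK hKΩ hε2
  refine ⟨a, h5, ?_, h7⟩
  calc ∫⁻ p in K, ENNReal.ofReal |a p - f p| ∂m
      ≤ ∫⁻ p in K, ENNReal.ofReal |a p - g p| + ENNReal.ofReal |g p - f p| ∂m := by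
        refine lintegral_mono fun p => ?_
        rw [← ENNReal.ofReal_add (abs_nonneg _) (abs_nonneg _)]
        exact ENNReal.ofReal_le_ofReal (abs_sub_le _ _ _)
    _ = ∫⁻ p in K, ENNReal.ofReal |a p - g p| ∂m + ∫⁻ p in K, ENNReal.ofReal |g p - f p| ∂m :=
        lintegral_add_right _ (by fun_prop)
    _ ≤ ε / 2 + ε / 2 := add_le_add h6 h2
    _ = ε := ENNReal.add_halves ε

/-- Gluing with a cutoff function: the total variation of `φ f + (1 - φ) g` on `W` is controlled
by those of `f` and `g`, up to the `L¹`-distance on the transition region `T`. -/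
lemma totVar_glue_le [ProperSpace X] {f g φ : X → ℝ} (hf : Measurable f) (hg : Measurable g)
    {L : NNReal} (hφ : LipschitzWith L φ) (h01 : ∀ p, φ p ∈ Set.Icc (0 : ℝ) 1)
    {U₁ U₂ W S₁ S₂ T : Set X} (hU₁ : IsOpen U₁) (hU₂ : IsOpen U₂) (hW : IsOpen W)
    (hS₁ : IsClosed S₁) (hS₂ : IsClosed S₂) (hφ0 : ∀ p ∉ S₁, φ p = 0) (hφ1 : ∀ p ∉ S₂, φ p = 1)
    (hWS₁ : W ∩ S₁ ⊆ U₁) (hWS₂ : W ∩ S₂ ⊆ U₂) (hT : IsCompact T) (hWT : W ∩ (S₁ ∩ S₂) ⊆ T)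
    (hTU₁ : T ⊆ U₁) (hTU₂ : T ⊆ U₂) :
    totVar m (fun p => φ p * f p + (1 - φ p) * g p) W ≤
      totVar m f U₁ + totVar m g U₂ + L * ∫⁻ p in T, ENNReal.ofReal |f p - g p| ∂m := by
  set I := ∫⁻ p in T, ENNReal.ofReal |f p - g p| ∂m with hI
  rcases eq_or_ne (totVar m f U₁) ∞ with h1 | h1
  · simp [h1]
  rcases eq_or_ne (totVar m g U₂) ∞ with h2 | h2
  · simp [h2]
  have hcov : ∀ p, p ∉ S₂ → p ∈ S₁ := by
    intro p hp
    by_contra h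
    have := hφ0 p h
    rw [hφ1 p hp] at this
    exact one_ne_zero this
  have hsplit : ∀ (A : Set X) (F : X → ℝ≥0∞), ∫⁻ p in A, F p ∂m ≤
      ∫⁻ p in A \ S₂, F p ∂m + (∫⁻ p in A \ S₁, F p ∂m + ∫⁻ p in A ∩ (S₁ ∩ S₂), F p ∂m) := by
    intro A F
    refine le_trans (lintegral_mono_set ?_) ((lintegral_union_le F (A \ S₂)
      ((A \ S₁) ∪ (A ∩ (S₁ ∩ S₂)))).trans (add_le_add le_rfl (lintegral_union_le F _ _)))
    intro p hp
    by_cases h2 : p ∈ S₂ <;> by_cases h1 : p ∈ S₁ <;> simp [hp, h1, h2]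
  refine totVar_le_of_approx hW fun K hK hKW ε hε => ?_
  obtain ⟨η, hη, hηε⟩ : ∃ η : ℝ≥0∞, η ≠ 0 ∧ η + η + (L * (η + η)) ≤ ε := by
    have ht : Tendsto (fun η : ℝ≥0∞ => η + η + (L * (η + η))) (𝓝[>] 0) (𝓝 0) := by
      have hc : Continuous (fun η : ℝ≥0∞ => η + η + (L * (η + η))) := by
        refine (continuous_id.add continuous_id).add ?_
        exact (ENNReal.continuous_const_mul ENNReal.coe_ne_top).comp (continuous_id.add continuous_id)
      simpa using (hc.tendsto 0).mono_left nhdsWithin_le_nhds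
    obtain ⟨η, h1, h2⟩ := ((ht.eventually_lt_const (pos_iff_ne_zero.2 hε)).and
      self_mem_nhdsWithin).exists
    exact ⟨η, (ne_of_gt h2), h1.le⟩
  obtain ⟨a, ha1, ha2, ha3⟩ := exists_approx_of_totVar_lt hU₁ (ENNReal.lt_add_right h1 hη)
    ((hK.inter_right hS₁).union hT)
    (union_subset ((inter_subset_inter_left _ hKW).trans hWS₁) hTU₁) hη
  obtain ⟨b, hb1, hb2, hb3⟩ := exists_approx_of_totVar_lt hU₂ (ENNReal.lt_add_right h2 hη)
    ((hK.inter_right hS₂).union hT)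
    (union_subset ((inter_subset_inter_left _ hKW).trans hWS₂) hTU₂) hη
  have hac := ha1.continuousOn hU₁
  have hbc := hb1.continuousOn hU₂
  have haT : AEMeasurable a (m.restrict T) := (hac.mono hTU₁).aemeasurable hT.measurableSet
  have hbT : AEMeasurable b (m.restrict T) := (hbc.mono hTU₂).aemeasurable hT.measurableSet
  have hS : MeasurableSet (S₁ ∩ S₂) := (hS₁.inter hS₂).measurableSet
  have heq1 : ∀ p ∉ S₂, (fun q => φ q * a q + (1 - φ q) * b q) =ᶠ[𝓝 p] a := by
    intro p hp
    filter_upwards [hS₂.isOpen_compl.mem_nhds hp] with q hq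
    simp [hφ1 q hq]
  have heq2 : ∀ p ∉ S₁, (fun q => φ q * a q + (1 - φ q) * b q) =ᶠ[𝓝 p] b := by
    intro p hp
    filter_upwards [hS₁.isOpen_compl.mem_nhds hp] with q hq
    simp [hφ0 q hq]
  refine ⟨fun q => φ q * a q + (1 - φ q) * b q, ?_, ?_, ?_⟩
  · refine (locLipOn_iff hW).2 fun p hp => ?_
    by_cases hp2 : p ∈ S₂
    · obtain ⟨Kb, t, ht, hb⟩ := (locLipOn_iff hU₂).1 hb1 p (hWS₂ ⟨hp, hp2⟩)
      by_cases hp1 : p ∈ S₁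
      · obtain ⟨Ka, s, hs, ha⟩ := (locLipOn_iff hU₁).1 ha1 p (hWS₁ ⟨hp, hp1⟩)
        exact LipschitzOnWith.exists_glue hφ h01 hs ht ha hb
      · refine ⟨Kb, _, inter_mem ht (hS₁.isOpen_compl.mem_nhds hp1), ?_⟩
        intro q hq q' hq'
        simpa [hφ0 q hq.2, hφ0 q' hq'.2] using hb hq.1 hq'.1
    · obtain ⟨Ka, s, hs, ha⟩ := (locLipOn_iff hU₁).1 ha1 p (hWS₁ ⟨hp, hcov p hp2⟩)
      refine ⟨Ka, _, inter_mem hs (hS₂.isOpen_compl.mem_nhds hp2), ?_⟩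
      intro q hq q' hq'
      simpa [hφ1 q hq.2, hφ1 q' hq'.2] using ha hq.1 hq'.1
  · have hpt : ∀ p, ENNReal.ofReal |φ p * a p + (1 - φ p) * b p - (φ p * f p + (1 - φ p) * g p)| ≤
        ENNReal.ofReal |a p - f p| + ENNReal.ofReal |b p - g p| := by
      intro p
      obtain ⟨h0, h1⟩ := h01 p
      rw [← ENNReal.ofReal_add (abs_nonneg _) (abs_nonneg _)]
      refine ENNReal.ofReal_le_ofReal ?_
      have : φ p * a p + (1 - φ p) * b p - (φ p * f p + (1 - φ p) * g p) =
          φ p * (a p - f p) + (1 - φ p) * (b p - g p) := by ring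
      rw [this]
      refine (abs_add_le _ _).trans (add_le_add ?_ ?_)
      · rw [abs_mul, abs_of_nonneg h0]
        exact mul_le_of_le_one_left (abs_nonneg _) h1
      · rw [abs_mul, abs_of_nonneg (by linarith : 0 ≤ 1 - φ p)]
        exact mul_le_of_le_one_left (abs_nonneg _) (by linarith)
    have e1 : ∫⁻ p in K \ S₂, ENNReal.ofReal
        |φ p * a p + (1 - φ p) * b p - (φ p * f p + (1 - φ p) * g p)| ∂m =
        ∫⁻ p in K \ S₂, ENNReal.ofReal |a p - f p| ∂m :=
      setLIntegral_congr_fun (hK.measurableSet.diff hS₂.measurableSet) fun p hp => by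
        simp [hφ1 p hp.2]
    have e2 : ∫⁻ p in K \ S₁, ENNReal.ofReal
        |φ p * a p + (1 - φ p) * b p - (φ p * f p + (1 - φ p) * g p)| ∂m =
        ∫⁻ p in K \ S₁, ENNReal.ofReal |b p - g p| ∂m :=
      setLIntegral_congr_fun (hK.measurableSet.diff hS₁.measurableSet) fun p hp => by
        simp [hφ0 p hp.2]
    have hKT : K ∩ (S₁ ∩ S₂) ⊆ T := (inter_subset_inter_left _ hKW).trans hWT
    have e3 : ∫⁻ p in K ∩ (S₁ ∩ S₂), ENNReal.ofReal
        |φ p * a p + (1 - φ p) * b p - (φ p * f p + (1 - φ p) * g p)| ∂m ≤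
        ∫⁻ p in K ∩ (S₁ ∩ S₂), ENNReal.ofReal |a p - f p| ∂m +
          ∫⁻ p in K ∩ (S₁ ∩ S₂), ENNReal.ofReal |b p - g p| ∂m := by
      refine (lintegral_mono hpt).trans (le_of_eq (lintegral_add_left' ?_ _))
      have := haT.mono_set hKT
      exact ((this.sub hf.aemeasurable).abs).ennreal_ofReal
    have e4 : ∫⁻ p in K \ S₂, ENNReal.ofReal |a p - f p| ∂m +
        ∫⁻ p in K ∩ (S₁ ∩ S₂), ENNReal.ofReal |a p - f p| ∂m ≤ η := by
      rw [← lintegral_union (hK.measurableSet.inter hS)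
        (Set.disjoint_left.2 fun p hp hp' => hp.2 hp'.2.2)]
      refine (lintegral_mono_set ?_).trans ha2
      rintro p (hp | hp)
      · exact Or.inl ⟨hp.1, hcov p hp.2⟩
      · exact Or.inl ⟨hp.1, hp.2.1⟩
    have e5 : ∫⁻ p in K \ S₁, ENNReal.ofReal |b p - g p| ∂m +
        ∫⁻ p in K ∩ (S₁ ∩ S₂), ENNReal.ofReal |b p - g p| ∂m ≤ η := by
      rw [← lintegral_union (hK.measurableSet.inter hS)
        (Set.disjoint_left.2 fun p hp hp' => hp.2 hp'.2.1)]
      refine (lintegral_mono_set ?_).trans hb2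
      rintro p (hp | hp)
      · exact Or.inl ⟨hp.1, by by_contra h; exact hp.2 (hcov p h)⟩
      · exact Or.inl ⟨hp.1, hp.2.2⟩
    refine (hsplit K _).trans ?_
    rw [e1, e2]
    calc _ ≤ _ := add_le_add le_rfl (add_le_add le_rfl e3)
      _ = (∫⁻ p in K \ S₂, ENNReal.ofReal |a p - f p| ∂m +
        ∫⁻ p in K ∩ (S₁ ∩ S₂), ENNReal.ofReal |a p - f p| ∂m) +
        (∫⁻ p in K \ S₁, ENNReal.ofReal |b p - g p| ∂m +
        ∫⁻ p in K ∩ (S₁ ∩ S₂), ENNReal.ofReal |b p - g p| ∂m) := by ring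
      _ ≤ η + η := add_le_add e4 e5
      _ ≤ ε := le_self_add.trans hηε
  · have e1 : ∫⁻ p in W \ S₂, mSlope (fun q => φ q * a q + (1 - φ q) * b q) p ∂m =
        ∫⁻ p in W \ S₂, mSlope a p ∂m :=
      setLIntegral_congr_fun (hW.measurableSet.diff hS₂.measurableSet) fun p hp =>
        mSlope_congr (heq1 p hp.2)
    have e2 : ∫⁻ p in W \ S₁, mSlope (fun q => φ q * a q + (1 - φ q) * b q) p ∂m =
        ∫⁻ p in W \ S₁, mSlope b p ∂m :=
      setLIntegral_congr_fun (hW.measurableSet.diff hS₁.measurableSet) fun p hp =>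
        mSlope_congr (heq2 p hp.2)
    have eab : ∫⁻ p in T, ENNReal.ofReal |a p - b p| ∂m ≤ I + (η + η) := by
      calc ∫⁻ p in T, ENNReal.ofReal |a p - b p| ∂m
          ≤ ∫⁻ p in T, (ENNReal.ofReal |f p - g p| +
              (ENNReal.ofReal |a p - f p| + ENNReal.ofReal |b p - g p|)) ∂m := by
            refine lintegral_mono fun p => ?_
            rw [← ENNReal.ofReal_add (abs_nonneg _) (abs_nonneg _),
              ← ENNReal.ofReal_add (abs_nonneg _) (by positivity)]
            refine ENNReal.ofReal_le_ofReal ?_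
            have : a p - b p = (f p - g p) + ((a p - f p) - (b p - g p)) := by ring
            rw [this]
            exact (abs_add_le _ _).trans (add_le_add le_rfl (abs_sub _ _))
        _ = I + (∫⁻ p in T, ENNReal.ofReal |a p - f p| ∂m +
              ∫⁻ p in T, ENNReal.ofReal |b p - g p| ∂m) := by
            rw [lintegral_add_left (by fun_prop), lintegral_add_left']
            exact ((haT.sub hf.aemeasurable).abs).ennreal_ofReal
        _ ≤ I + (η + η) := by
            gcongr
            · exact (lintegral_mono_set subset_union_right).trans ha2
            · exact (lintegral_mono_set subset_union_right).trans hb2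
    have e3 : ∫⁻ p in W ∩ (S₁ ∩ S₂), mSlope (fun q => φ q * a q + (1 - φ q) * b q) p ∂m ≤
        ∫⁻ p in W ∩ (S₁ ∩ S₂), mSlope a p ∂m + (∫⁻ p in W ∩ (S₁ ∩ S₂), mSlope b p ∂m +
          L * (I + (η + η))) := by
      have hm1 : AEMeasurable (mSlope a) (m.restrict (W ∩ (S₁ ∩ S₂))) :=
        (aemeasurable_mSlope m hU₁ hac).mono_set (hWT.trans hTU₁)
      have hm2 : AEMeasurable (mSlope b) (m.restrict (W ∩ (S₁ ∩ S₂))) :=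
        (aemeasurable_mSlope m hU₂ hbc).mono_set (hWT.trans hTU₂)
      calc _ ≤ ∫⁻ p in W ∩ (S₁ ∩ S₂), (mSlope a p + (mSlope b p +
              L * ENNReal.ofReal |a p - b p|)) ∂m := by
            refine setLIntegral_mono' (hW.measurableSet.inter hS) fun p hp => ?_
            exact mSlope_glue_le hφ h01 (hac.continuousAt (hU₁.mem_nhds (hTU₁ (hWT hp))))
              (hbc.continuousAt (hU₂.mem_nhds (hTU₂ (hWT hp))))
        _ = ∫⁻ p in W ∩ (S₁ ∩ S₂), mSlope a p ∂m + (∫⁻ p in W ∩ (S₁ ∩ S₂), mSlope b p ∂m +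
              L * ∫⁻ p in W ∩ (S₁ ∩ S₂), ENNReal.ofReal |a p - b p| ∂m) := by
            rw [lintegral_add_left' hm1, lintegral_add_left' hm2,
              lintegral_const_mul' _ _ ENNReal.coe_ne_top]
        _ ≤ _ := by
            gcongr
            exact (lintegral_mono_set hWT).trans eab
    have e4 : ∫⁻ p in W \ S₂, mSlope a p ∂m + ∫⁻ p in W ∩ (S₁ ∩ S₂), mSlope a p ∂m ≤
        totVar m f U₁ + η := by
      rw [← lintegral_union (hW.measurableSet.inter hS)
        (Set.disjoint_left.2 fun p hp hp' => hp.2 hp'.2.2)]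
      refine (lintegral_mono_set ?_).trans ha3
      rintro p (hp | hp)
      · exact hWS₁ ⟨hp.1, hcov p hp.2⟩
      · exact hWS₁ ⟨hp.1, hp.2.1⟩
    have e5 : ∫⁻ p in W \ S₁, mSlope b p ∂m + ∫⁻ p in W ∩ (S₁ ∩ S₂), mSlope b p ∂m ≤
        totVar m g U₂ + η := by
      rw [← lintegral_union (hW.measurableSet.inter hS)
        (Set.disjoint_left.2 fun p hp hp' => hp.2 hp'.2.1)]
      refine (lintegral_mono_set ?_).trans hb3
      rintro p (hp | hp)
      · exact hWS₂ ⟨hp.1, by by_contra h; exact hp.2 (hcov p h)⟩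
      · exact hWS₂ ⟨hp.1, hp.2.2⟩
    refine (hsplit W _).trans ?_
    rw [e1, e2]
    calc _ ≤ _ := add_le_add le_rfl (add_le_add le_rfl e3)
      _ = (∫⁻ p in W \ S₂, mSlope a p ∂m + ∫⁻ p in W ∩ (S₁ ∩ S₂), mSlope a p ∂m) +
        (∫⁻ p in W \ S₁, mSlope b p ∂m + ∫⁻ p in W ∩ (S₁ ∩ S₂), mSlope b p ∂m) +
          L * (I + (η + η)) := by ring
      _ ≤ (totVar m f U₁ + η) + (totVar m g U₂ + η) + L * (I + (η + η)) := by gcongr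
      _ = totVar m f U₁ + totVar m g U₂ + L * I + (η + η + L * (η + η)) := by ring
      _ ≤ _ := by gcongr

end TotalVariation

section Geometry

variable [MetricSpace X] [MeasurableSpace X] {m : Measure X}

lemma UnifLocDoublingWith.iterate {C_D : ℝ → ℝ} (hd : UnifLocDoublingWith C_D m) {R : ℝ}
    (p : X) {t : ℝ} (ht : 0 < t) (k : ℕ) (hk : 2 ^ k * t ≤ R) :
    m (ball p (2 ^ k * t)) ≤ ENNReal.ofReal (C_D R) ^ k * m (ball p t) := by
  induction k with
  | zero => simp
  | succ k ih =>
    have h1 : 2 ^ k * t < R := by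
      have : 0 < 2 ^ k * t := by positivity
      rw [pow_succ] at hk
      linarith
    have h2 : 0 < 2 ^ k * t := by positivity
    calc m (ball p (2 ^ (k + 1) * t)) = m (ball p (2 * (2 ^ k * t))) := by ring_nf
      _ ≤ ENNReal.ofReal (C_D R) * m (ball p (2 ^ k * t)) := hd R (h2.trans h1) p _ h2 h1
      _ ≤ ENNReal.ofReal (C_D R) * (ENNReal.ofReal (C_D R) ^ k * m (ball p t)) := by
          gcongr
          exact ih h1.le
      _ = _ := by rw [pow_succ]; ring

lemma UnifLocDoublingWith.measure_ball_pos {C_D : ℝ → ℝ} (hd : UnifLocDoublingWith C_D m)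
    {s : Set X} (hs : m s ≠ 0) (p : X) {t : ℝ} (ht : 0 < t) : 0 < m (ball p t) := by
  by_contra! h0
  have h0 : m (ball p t) = 0 := le_antisymm h0 zero_le
  have h1 : ∀ k : ℕ, m (ball p (2 ^ k * t)) = 0 := fun k => by
    simpa [h0] using hd.iterate p ht k le_rfl
  refine hs (measure_mono_null (t := ⋃ k : ℕ, ball p (2 ^ k * t)) (fun q _ => ?_)
    (measure_iUnion_null h1))
  obtain ⟨k, hk⟩ := pow_unbounded_of_one_lt (dist q p / t) one_lt_two
  exact mem_iUnion.2 ⟨k, (div_lt_iff₀ ht).1 hk⟩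

lemma isUnifLocDoublingMeasure_of_doubling {C_D : ℝ → ℝ} (hd : UnifLocDoublingWith C_D m) :
    IsUnifLocDoublingMeasure m := by
  refine ⟨⟨Real.toNNReal (C_D 1) ^ 2, ?_⟩⟩
  filter_upwards [Ioo_mem_nhdsGT (show (0 : ℝ) < 1 / 4 by norm_num)] with ε hε x
  have h := hd.iterate (R := 1) x hε.1 2 (by linarith [hε.2])
  refine (measure_mono (closedBall_subset_ball (by linarith [hε.1]))).trans (h.trans ?_)
  rw [ENNReal.coe_pow]
  exact mul_le_mul_right (measure_mono ball_subset_closedBall) _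

lemma exists_stopping_radius {C_D : ℝ → ℝ} (hd : UnifLocDoublingWith C_D m) {R : ℝ} {r : ℝ}
    (hr : 0 < r) (hrR : 2 * r ≤ R) {x p : X} {G : Set X} (hG : MeasurableSet G) (hGx : G ⊆ ball x r)
    (hGt : m G ≠ ∞) (hp : p ∈ G)
    (hsmall : ENNReal.ofReal (C_D R) * (2 * m G) < m (ball x r))
    (hdens : ∃ k : ℕ, m (ball p (r / 2 ^ k)) < 2 * m (G ∩ ball p (r / 2 ^ k))) :
    ∃ j : ℕ, m (G ∩ ball p (r / 2 ^ j)) ≤ m (ball p (r / 2 ^ j) \ G) ∧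
      m (ball p (r / 2 ^ j)) ≤ ENNReal.ofReal (C_D R) * (2 * m (G ∩ ball p (r / 2 ^ j))) ∧
      m (ball x r) ≤ ENNReal.ofReal (C_D R) ^ (j + 1) * m (ball p (r / 2 ^ j)) := by
  classical
  set C := ENNReal.ofReal (C_D R)
  have hR : 0 < R := by linarith
  have hxp : ball x r ⊆ ball p (2 * r) := by
    refine ball_subset_ball' ?_
    have := hGx hp
    rw [mem_ball, dist_comm] at this
    linarith
  have hball : ∀ j : ℕ, m (ball x r) ≤ C ^ (j + 1) * m (ball p (r / 2 ^ j)) := by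
    intro j
    have h2 : (2 : ℝ) ^ (j + 1) * (r / 2 ^ j) = 2 * r := by
      field_simp
      ring
    have := hd.iterate (R := R) p (show 0 < r / 2 ^ j by positivity) (j + 1) (h2.le.trans hrR)
    rw [h2] at this
    exact (measure_mono hxp).trans this
  have hk := Nat.find_spec hdens
  have hmin := fun j => Nat.find_min hdens (m := j)
  set k := Nat.find hdens
  rcases k with _ | j
  · exfalso
    have h1 := hball 0
    simp only [pow_zero, div_one, zero_add, pow_one] at h1 hk
    have h2 : m (ball p r) ≤ 2 * m G := hk.le.trans (mul_le_mul_right (measure_mono inter_subset_left) _)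
    exact absurd (h1.trans (mul_le_mul_right h2 _)) (not_le.2 hsmall)
  · refine ⟨j, ?_, ?_, hball j⟩
    · have h1 := not_lt.1 (hmin j (Nat.lt_succ_self j))
      rw [← measure_inter_add_sdiff (ball p (r / 2 ^ j)) hG, inter_comm G, two_mul] at h1
      rw [inter_comm]
      exact (ENNReal.add_le_add_iff_left (measure_ne_top_of_subset inter_subset_right hGt)).1 h1
    · have h2 : r / 2 ^ j = 2 * (r / 2 ^ (j + 1)) := by
        rw [pow_succ]
        field_simp
      calc m (ball p (r / 2 ^ j)) ≤ C * m (ball p (r / 2 ^ (j + 1))) := by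
            rw [h2]
            refine hd R hR p _ (by positivity) ?_
            have : r / 2 ^ (j + 1) ≤ r := div_le_self hr.le (one_le_pow₀ one_le_two)
            linarith
        _ ≤ C * (2 * m (G ∩ ball p (r / 2 ^ (j + 1)))) := mul_le_mul_right hk.le _
        _ ≤ C * (2 * m (G ∩ ball p (r / 2 ^ j))) := by
            gcongr
            · exact one_le_two
            · exact Nat.le_succ j

variable [BorelSpace X]

lemma properSpace_of_doubling [CompleteSpace X] {C_D : ℝ → ℝ} (hbf : BoundedlyFinite m)
    (hd : UnifLocDoublingWith C_D m) {s : Set X} (hs : m s ≠ 0) : ProperSpace X := by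
  refine ⟨fun x r => TotallyBounded.isCompact_of_isClosed ?_ isClosed_closedBall⟩
  refine Metric.totallyBounded_iff.2 fun ε hε => ?_
  obtain ⟨u, hu, hdis, hcov⟩ := Vitali.exists_disjoint_subfamily_covering_enlargement_closedBall
    (closedBall x r) id (fun _ => ε / 5) (ε / 5) (fun _ _ => le_rfl) 4 (by norm_num)
  refine ⟨u, ?_, fun p hp => ?_⟩
  · obtain ⟨k, hk⟩ := pow_unbounded_of_one_lt ((r + 1) / (ε / 5)) one_lt_two
    have hk' : r + 1 < 2 ^ k * (ε / 5) := (div_lt_iff₀ (by positivity)).1 hk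
    set R := 2 ^ k * (ε / 5)
    set c := m (ball x 1) / ENNReal.ofReal (C_D R) ^ k
    have hpos := hd.measure_ball_pos hs x one_pos
    have hle : ∀ p ∈ closedBall x r, c ≤ m (closedBall p (ε / 5)) := by
      intro p hp
      refine ENNReal.div_le_of_le_mul' ?_
      refine le_trans (measure_mono ?_) ((hd.iterate (R := R) p (by positivity) k le_rfl).trans
        (mul_le_mul_right (measure_mono ball_subset_closedBall) _))
      refine ball_subset_ball' ?_
      rw [mem_closedBall, dist_comm] at hp
      have : 1 + dist x p ≤ R := by linarith
      exact this
    have hc : 0 < c := ENNReal.div_pos hpos.ne' (ENNReal.pow_ne_top ENNReal.ofReal_ne_top)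
    have hfin : (Set.univ : Set u).Finite := by
      refine (Measure.finite_const_le_meas_of_disjoint_iUnion m hc
        (As := fun p : u => closedBall (p : X) (ε / 5)) (fun p => isClosed_closedBall.measurableSet)
        ?_ ?_).subset fun p _ => hle p (hu p.2)
      · exact fun p q hpq => hdis p.2 q.2 (Subtype.coe_injective.ne hpq)
      · refine ((measure_mono (iUnion_subset fun p => ?_)).trans_lt
          (hbf (closedBall x (r + ε / 5)) isBounded_closedBall)).ne
        refine closedBall_subset_closedBall' ?_
        have := hu p.2
        rw [mem_closedBall] at this
        linarith
    exact Set.finite_univ_iff.1 hfin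
  · obtain ⟨b, hb, hpb⟩ := hcov p hp
    refine mem_iUnion₂.2 ⟨b, hb, ?_⟩
    have := hpb (mem_closedBall_self (by positivity))
    simp only [id, mem_closedBall] at this
    rw [mem_ball]
    linarith

lemma IsLengthSpace.exists_between {X : Type*} [MetricSpace X] (hlen : IsLengthSpace X) (y p : X)
    {t : ℝ} (ht0 : 0 < t) (ht : t ≤ dist y p) :
    ∃ q, dist q p = t / 2 ∧ dist y q < dist y p - t / 4 := by
  have hlt : ⨅ (γ : ℝ → X) (_ : ContinuousOn γ (Set.Icc 0 1)) (_ : γ 0 = y) (_ : γ 1 = p),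
      eVariationOn γ (Set.Icc 0 1) < ENNReal.ofReal (dist y p + t / 4) := by
    rw [← hlen]
    exact (ENNReal.ofReal_lt_ofReal_iff (by linarith)).2 (by linarith)
  simp only [iInf_lt_iff] at hlt
  obtain ⟨γ, hγ, h0, h1, hv⟩ := hlt
  have hcont : ContinuousOn (fun τ => dist (γ τ) p) (Set.Icc 0 1) := 
    (continuous_id.dist continuous_const).comp_continuousOn hγ
  obtain ⟨τ, hτ, hτt⟩ : t / 2 ∈ (fun τ => dist (γ τ) p) '' Set.Icc 0 1 := by
    refine intermediate_value_Icc' zero_le_one hcont ⟨?_, ?_⟩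
    · simp only [h1, dist_self]
      positivity
    · simp only [h0]
      linarith
  refine ⟨γ τ, hτt, ?_⟩
  have h2 := eVariationOn.Icc_add_Icc γ (s := Set.Icc 0 1) hτ.1 hτ.2 hτ
  have h3 : edist (γ 0) (γ τ) ≤ eVariationOn γ (Set.Icc 0 1 ∩ Set.Icc 0 τ) :=
    eVariationOn.edist_le γ ⟨⟨le_rfl, zero_le_one⟩, ⟨le_rfl, hτ.1⟩⟩ ⟨hτ, ⟨hτ.1, le_rfl⟩⟩
  have h4 : edist (γ τ) (γ 1) ≤ eVariationOn γ (Set.Icc 0 1 ∩ Set.Icc τ 1) :=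
    eVariationOn.edist_le γ ⟨hτ, ⟨le_rfl, hτ.2⟩⟩ ⟨⟨zero_le_one, le_rfl⟩, ⟨hτ.2, le_rfl⟩⟩
  rw [Set.inter_self] at h2
  have h5 : edist (γ 0) (γ τ) + edist (γ τ) (γ 1) < ENNReal.ofReal (dist y p + t / 4) :=
    (add_le_add h3 h4).trans_lt (h2 ▸ hv)
  rw [h0, h1, edist_dist, edist_dist, ← ENNReal.ofReal_add dist_nonneg dist_nonneg,
    ENNReal.ofReal_lt_ofReal_iff (by linarith)] at h5
  simp only at hτt
  linarith

lemma measure_sphere_eq_zero [SecondCountableTopology X] {C_D : ℝ → ℝ} (hbf : BoundedlyFinite m)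
    (hd : UnifLocDoublingWith C_D m) (hlen : IsLengthSpace X) (y : X) {s : ℝ} (hs : 0 < s) :
    m (sphere y s) = 0 := by
  have := isUnifLocDoublingMeasure_of_doubling hd
  have : IsLocallyFiniteMeasure m :=
    ⟨fun x => ⟨ball x 1, ball_mem_nhds x one_pos, hbf _ isBounded_ball⟩⟩
  by_contra hne
  have hdens := IsUnifLocDoublingMeasure.ae_tendsto_measure_inter_div m (sphere y s) 1
  have : (ae (m.restrict (sphere y s))).NeBot := by
    rw [ae_neBot]
    simpa using hne
  obtain ⟨p, hp, hps⟩ :=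
    (hdens.and (ae_restrict_mem (isClosed_sphere (x := y) (ε := s)).measurableSet)).exists
  have hlim := hp (l := 𝓝[>] (0 : ℝ)) (fun _ => p) id tendsto_id (by
    filter_upwards [self_mem_nhdsWithin] with t ht
    simpa using (le_of_lt ht))
  set C := ENNReal.ofReal (C_D 2) with hC
  have hev : ∀ᶠ t in 𝓝[>] (0 : ℝ),
      m (sphere y s ∩ closedBall p t) / m (closedBall p t) + (C ^ 3)⁻¹ ≤ 1 := by
    filter_upwards [Ioo_mem_nhdsGT (show (0 : ℝ) < min s 1 by positivity)] with t ht
    have hts : t < s := ht.2.trans_le (min_le_left _ _)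
    have ht1 : t < 1 := ht.2.trans_le (min_le_right _ _)
    rw [mem_sphere, dist_comm] at hps
    obtain ⟨q, hq1, hq2⟩ := hlen.exists_between y p ht.1 (by linarith)
    have hpos : 0 < m (ball q (t / 4)) := hd.measure_ball_pos hne q (by linarith [ht.1])
    have h1 : m (sphere y s ∩ closedBall p t) + m (ball q (t / 4)) ≤ m (closedBall p t) := by
      rw [← measure_union (Set.disjoint_left.2 fun z hz hz' => ?_) isOpen_ball.measurableSet]
      · refine measure_mono (union_subset inter_subset_right fun z hz => ?_)
        rw [mem_ball] at hz
        rw [mem_closedBall]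
        linarith [dist_triangle z q p, ht.1]
      · have h1 := hz.1
        rw [mem_ball] at hz'
        rw [mem_sphere] at h1
        linarith [dist_triangle z q y, dist_comm q y]
    have h2 : m (closedBall p t) ≤ C ^ 3 * m (ball q (t / 4)) := by
      refine (measure_mono fun z hz => ?_).trans
        (hd.iterate (R := 2) q (by linarith [ht.1]) 3 (by linarith))
      rw [mem_closedBall] at hz
      rw [mem_ball]
      linarith [dist_triangle z p q, dist_comm q p, ht.1]
    have hB0 : m (closedBall p t) ≠ 0 :=
      ((hd.measure_ball_pos hne p ht.1).trans_le (measure_mono ball_subset_closedBall)).ne'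
    have hBt : m (closedBall p t) ≠ ∞ := (hbf _ isBounded_closedBall).ne
    have h3 : (C ^ 3)⁻¹ ≤ m (ball q (t / 4)) / m (closedBall p t) := by
      rw [ENNReal.le_div_iff_mul_le (Or.inl hB0) (Or.inl hBt), mul_comm, ← div_eq_mul_inv]
      exact ENNReal.div_le_of_le_mul' h2
    calc _ ≤ m (sphere y s ∩ closedBall p t) / m (closedBall p t) +
          m (ball q (t / 4)) / m (closedBall p t) := by gcongr
      _ = (m (sphere y s ∩ closedBall p t) + m (ball q (t / 4))) / m (closedBall p t) :=
          (ENNReal.add_div).symm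
      _ ≤ 1 := ENNReal.div_le_of_le_mul (by simpa using h1)
  have hfin := le_of_tendsto (hlim.add_const (C ^ 3)⁻¹) hev
  have : (C ^ 3)⁻¹ ≠ 0 := ENNReal.inv_ne_zero.2 (ENNReal.pow_ne_top ENNReal.ofReal_ne_top)
  exact absurd hfin (not_le.2 (ENNReal.lt_add_right ENNReal.one_ne_top this))

lemma continuousOn_measure_ball_inter (hbf : BoundedlyFinite m) (y : X)
    (hsph : ∀ s, 0 < s → m (sphere y s) = 0) {G : Set X} (hG : MeasurableSet G) :
    ContinuousOn (fun s => m (ball y s ∩ G)) (Ioi 0) := by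
  intro s hs
  refine ContinuousAt.continuousWithinAt ?_
  refine tendsto_measure_of_ae_tendsto_indicator (𝓝 s) (isOpen_ball.measurableSet.inter hG)
    (fun i => isOpen_ball.measurableSet.inter hG) (B := ball y (s + 1)) isOpen_ball.measurableSet
    (hbf _ isBounded_ball).ne ?_ ?_
  · filter_upwards [gt_mem_nhds (lt_add_one s)] with i hi
    exact inter_subset_left.trans (ball_subset_ball hi.le)
  · have : ∀ᵐ x ∂m, x ∉ sphere y s := measure_eq_zero_iff_ae_notMem.1 (hsph s hs)
    filter_upwards [this] with x hx
    rw [mem_sphere] at hx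
    rcases lt_or_gt_of_ne hx with h | h
    · filter_upwards [lt_mem_nhds h] with i hi
      simp [h, hi]
    · filter_upwards [gt_mem_nhds h] with i hi
      simp [not_lt.2 h.le, not_lt.2 hi.le]

end Geometry

section Isoperimetric

variable [MetricSpace X] [MeasurableSpace X] [BorelSpace X] {m : Measure X}

lemma measure_inter_ball_le_of_poincare {lam : ℝ} {C_P : ℝ → ℝ} (hlam : 1 ≤ lam)
    (hP : WeakPoincareWith lam C_P m) (hbf : BoundedlyFinite m) {p : X} {ρ : ℝ} (hρ : 0 < ρ)
    (hρ1 : ρ < 1) (hpos : m (ball p ρ) ≠ 0) {G : Set X} (hG : MeasurableSet G)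
    (hhalf : m (G ∩ ball p ρ) ≤ m (ball p ρ \ G)) {f : X → ℝ} (hf : LocLipOn Set.univ f) :
    m (G ∩ ball p ρ) ≤ 2 * (ENNReal.ofReal (C_P 1 * ρ) * ∫⁻ q in ball p (lam * ρ), mSlope f q ∂m +
      ∫⁻ q in ball p ρ, ENNReal.ofReal |f q - G.indicator (fun _ => (1 : ℝ)) q| ∂m) := by
  set B := ball p ρ
  set a : ℝ := ⨍ z in B, f z ∂m
  set χ : X → ℝ := G.indicator fun _ => (1 : ℝ)
  have hB : MeasurableSet B := isOpen_ball.measurableSet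
  have hBt : m B ≠ ∞ := (hbf _ isBounded_ball).ne
  have hBl : m B ≤ m (ball p (lam * ρ)) :=
    measure_mono (ball_subset_ball (le_mul_of_one_le_left hρ.le hlam))
  have hfc : Continuous f := by
    simpa [continuousOn_univ] using hf.continuousOn isOpen_univ
  have h1 : ∫⁻ q in B, ENNReal.ofReal |f q - a| ∂m ≤
      ENNReal.ofReal (C_P 1 * ρ) * ∫⁻ q in ball p (lam * ρ), mSlope f q ∂m := by
    have h := hP f hf 1 one_pos p ρ hρ hρ1
    rw [ENNReal.div_le_iff hpos hBt] at h
    refine h.trans ?_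
    rw [mul_assoc]
    refine mul_le_mul_right ?_ _
    calc _ ≤ (∫⁻ q in ball p (lam * ρ), mSlope f q ∂m) / m (ball p (lam * ρ)) *
          m (ball p (lam * ρ)) := mul_le_mul_right hBl _
      _ = _ := ENNReal.div_mul_cancel (fun h => hpos (le_zero_iff.1 (hBl.trans h.le)))
          (hbf _ isBounded_ball).ne
  have h2 : ∫⁻ q in B, ENNReal.ofReal |χ q - a| ∂m ≤
      ∫⁻ q in B, ENNReal.ofReal |f q - a| ∂m + ∫⁻ q in B, ENNReal.ofReal |f q - χ q| ∂m := by
    rw [← lintegral_add_left (by fun_prop)]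
    refine lintegral_mono fun q => ?_
    rw [← ENNReal.ofReal_add (abs_nonneg _) (abs_nonneg _)]
    refine ENNReal.ofReal_le_ofReal ?_
    rw [abs_sub_comm (f q) (χ q), add_comm]
    exact abs_sub_le _ _ _
  have h3 : ∀ s, MeasurableSet s → s ⊆ B → (∀ q ∈ s, 1 / 2 ≤ |χ q - a|) →
      m s ≤ 2 * ∫⁻ q in B, ENNReal.ofReal |χ q - a| ∂m := by
    intro s hs hsB hle
    have : ∫⁻ _ in s, (2 : ℝ≥0∞)⁻¹ ∂m ≤ ∫⁻ q in B, ENNReal.ofReal |χ q - a| ∂m := by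
      refine le_trans (setLIntegral_mono' hs fun q hq => ?_) (lintegral_mono_set hsB)
      have := ENNReal.ofReal_le_ofReal (hle q hq)
      rwa [one_div, ENNReal.ofReal_inv_of_pos two_pos, ENNReal.ofReal_ofNat] at this
    rw [setLIntegral_const] at this
    calc m s = 2 * (2⁻¹ * m s) := by
          rw [← mul_assoc, ENNReal.mul_inv_cancel two_ne_zero ENNReal.ofNat_ne_top, one_mul]
      _ ≤ _ := mul_le_mul_right this _
  have h4 : m (G ∩ B) ≤ 2 * ∫⁻ q in B, ENNReal.ofReal |χ q - a| ∂m := by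
    rcases le_total a (1 / 2) with ha | ha
    · refine h3 _ (hG.inter hB) inter_subset_right fun q hq => ?_
      have : χ q = 1 := indicator_of_mem hq.1 _
      rw [this, abs_of_nonneg (by linarith)]
      linarith
    · refine hhalf.trans (h3 _ (hB.diff hG) sdiff_subset fun q hq => ?_)
      have : χ q = 0 := indicator_of_notMem hq.2 _
      rw [this, zero_sub, abs_neg]
      exact ha.trans (le_abs_self a)
  exact h4.trans (mul_le_mul_right (h2.trans (add_le_add h1 le_rfl)) _)

lemma sum_measure_inter_ball_le [ProperSpace X] {lam : ℝ} {C_P : ℝ → ℝ} (hlam : 1 ≤ lam)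
    (hP : WeakPoincareWith lam C_P m) (hCP : 0 < C_P 1) (hbf : BoundedlyFinite m)
    (hpos : ∀ p (t : ℝ), 0 < t → m (ball p t) ≠ 0) {G : Set X} (hG : MeasurableSet G)
    (F : Finset X) (ρ : X → ℝ) {ρm : ℝ} (hρ : ∀ p ∈ F, 0 < ρ p) (hρ1 : ∀ p ∈ F, ρ p < 1)
    (hρm : ∀ p ∈ F, ρ p ≤ ρm)
    (hdis : (F : Set X).PairwiseDisjoint fun p => closedBall p (lam * ρ p))
    (hhalf : ∀ p ∈ F, m (G ∩ ball p (ρ p)) ≤ m (ball p (ρ p) \ G)) :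
    ∑ p ∈ F, m (G ∩ ball p (ρ p)) ≤ 2 * (ENNReal.ofReal (C_P 1 * ρm) * Per m G Set.univ) := by
  rcases F.eq_empty_or_nonempty with rfl | ⟨p₀, hp₀⟩
  · simp
  have hρm0 : 0 < ρm := (hρ p₀ hp₀).trans_le (hρm p₀ hp₀)
  have hA0 : ENNReal.ofReal (C_P 1 * ρm) ≠ 0 := by
    rw [Ne, ENNReal.ofReal_eq_zero, not_le]
    positivity
  rcases eq_or_ne (Per m G Set.univ) ∞ with h | h
  · simp [h, ENNReal.mul_top hA0]
  set P := Per m G Set.univ with hPdef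
  set A := ENNReal.ofReal (C_P 1 * ρm)
  have key : ∀ ε : ℝ≥0∞, ε ≠ 0 → ∑ p ∈ F, m (G ∩ ball p (ρ p)) ≤ 2 * (A * (P + ε) + ε) := by
    intro ε hε
    obtain ⟨f, hf1, hf2, hf3⟩ := exists_approx_of_totVar_lt isOpen_univ
      (ENNReal.lt_add_right h hε) (F.isCompact_biUnion fun p _ => isCompact_closedBall p (lam * ρ p))
      (subset_univ _) hε
    have hsub : ∀ p ∈ F, ball p (ρ p) ⊆ closedBall p (lam * ρ p) := fun p hp =>
      (ball_subset_ball (le_mul_of_one_le_left (hρ p hp).le hlam)).trans ball_subset_closedBall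
    calc ∑ p ∈ F, m (G ∩ ball p (ρ p))
        ≤ ∑ p ∈ F, 2 * (A * ∫⁻ q in ball p (lam * ρ p), mSlope f q ∂m +
          ∫⁻ q in ball p (ρ p), ENNReal.ofReal |f q - G.indicator (fun _ => (1 : ℝ)) q| ∂m) := by
          refine Finset.sum_le_sum fun p hp => ?_
          refine (measure_inter_ball_le_of_poincare hlam hP hbf (hρ p hp) (hρ1 p hp)
            (hpos p _ (hρ p hp)) hG (hhalf p hp) hf1).trans ?_
          gcongr
          exact ENNReal.ofReal_le_ofReal (mul_le_mul_of_nonneg_left (hρm p hp) hCP.le)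
      _ = 2 * (A * ∑ p ∈ F, ∫⁻ q in ball p (lam * ρ p), mSlope f q ∂m +
          ∑ p ∈ F, ∫⁻ q in ball p (ρ p),
            ENNReal.ofReal |f q - G.indicator (fun _ => (1 : ℝ)) q| ∂m) := by
          rw [← Finset.mul_sum, Finset.sum_add_distrib, ← Finset.mul_sum]
      _ ≤ 2 * (A * (P + ε) + ε) := by
          gcongr
          · rw [← lintegral_biUnion_finset (hdis.mono fun p => ball_subset_closedBall)
              fun p _ => isOpen_ball.measurableSet]
            exact (lintegral_mono_set (subset_univ _)).trans hf3
          · rw [← lintegral_biUnion_finset (fun p hp q hq hpq =>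
                (hdis hp hq hpq).mono (hsub p hp) (hsub q hq))
              fun p _ => isOpen_ball.measurableSet]
            exact (lintegral_mono_set (iUnion₂_mono hsub)).trans hf2
  have hlim : Tendsto (fun ε : ℝ≥0∞ => 2 * (A * (P + ε) + ε)) (𝓝[>] 0) (𝓝 (2 * (A * P))) := by
    have hc : Continuous (fun ε : ℝ≥0∞ => 2 * (A * (P + ε) + ε)) := by
      refine (ENNReal.continuous_const_mul ENNReal.ofNat_ne_top).comp ?_
      refine ((ENNReal.continuous_const_mul ENNReal.ofReal_ne_top).comp
        (continuous_const.add continuous_id)).add continuous_id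
    simpa using (hc.tendsto 0).mono_left nhdsWithin_le_nhds
  refine ge_of_tendsto hlim ?_
  filter_upwards [self_mem_nhdsWithin] with ε hε
  exact key ε (ne_of_gt hε)

/-- Isoperimetric inequality in small balls: if `G ⊆ ball x r` occupies a small portion of
`ball x r`, then its measure is controlled by its perimeter times the typical scale `ρm` at which
`G` has density bounded away from `0` and `1`. -/
lemma exists_isoperimetric [ProperSpace X] {C_D : ℝ → ℝ} (hbf : BoundedlyFinite m)
    (hd : UnifLocDoublingWith C_D m) {lam : ℝ} {C_P : ℝ → ℝ} (hlam : 1 ≤ lam)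
    (hP : WeakPoincareWith lam C_P m) (hCP : 0 < C_P 1)
    (hpos : ∀ p (t : ℝ), 0 < t → m (ball p t) ≠ 0)
    (hsph : ∀ p (s : ℝ), 0 < s → m (sphere p s) = 0) :
    ∃ R : ℝ, 2 ≤ R ∧ ∃ A : ℝ, 0 < A ∧ ∀ (x : X) (r : ℝ) (G : Set X), 0 < r → r < 1 →
      MeasurableSet G → G ⊆ ball x r → ENNReal.ofReal (C_D R) * (2 * m G) < m (ball x r) →
      ∀ ρm : ℝ, 0 ≤ ρm →
      (∀ j : ℕ, m (ball x r) ≤ ENNReal.ofReal (C_D R) ^ (j + 2) * (2 * m G) → r / 2 ^ j ≤ ρm) →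
      m G ≤ ENNReal.ofReal (A * ρm) * Per m G Set.univ := by
  obtain ⟨k, hk⟩ := pow_unbounded_of_one_lt (4 * lam) one_lt_two
  have hk2 : 2 ≤ (2 : ℝ) ^ k := by linarith
  set R : ℝ := 2 ^ k
  set C := ENNReal.ofReal (C_D R) with hC
  have hCt : C ≠ ∞ := ENNReal.ofReal_ne_top
  set D := (C ^ k * (C * 2)).toReal with hD
  have hDt : C ^ k * (C * 2) ≠ ∞ := by finiteness
  refine ⟨R, hk2, (D + 1) * 2 * C_P 1, by positivity, ?_⟩
  intro x r G hr hr1 hG hGx hsmall ρm hρm0 hρm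
  have hGt : m G ≠ ∞ := measure_ne_top_of_subset hGx (hbf _ isBounded_ball).ne
  have hdm := isUnifLocDoublingMeasure_of_doubling hd
  have : IsLocallyFiniteMeasure m :=
    ⟨fun x => ⟨ball x 1, ball_mem_nhds x one_pos, hbf _ isBounded_ball⟩⟩
  have hdens := IsUnifLocDoublingMeasure.ae_tendsto_measure_inter_div m G 1
  have hcb : ∀ p (s : ℝ) (A : Set X), 0 < s → m (A ∩ closedBall p s) = m (A ∩ ball p s) := by
    intro p s A hs
    refine le_antisymm ?_ (measure_mono (inter_subset_inter_right _ ball_subset_closedBall))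
    calc m (A ∩ closedBall p s) ≤ m ((A ∩ ball p s) ∪ sphere p s) := measure_mono (by
          rw [← ball_union_sphere]
          exact fun q hq => hq.2.imp (fun h => ⟨hq.1, h⟩) id)
      _ ≤ m (A ∩ ball p s) + m (sphere p s) := measure_union_le _ _
      _ = _ := by rw [hsph p s hs, add_zero]
  have hae : ∀ᵐ p ∂m.restrict G,
      ∃ k : ℕ, m (ball p (r / 2 ^ k)) < 2 * m (G ∩ ball p (r / 2 ^ k)) := by
    filter_upwards [hdens] with p hp
    have hto : Tendsto (fun k : ℕ => r / 2 ^ k) atTop (𝓝[>] 0) := by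
      refine tendsto_nhdsWithin_iff.2 ⟨?_, Eventually.of_forall fun k => by
        simp only [mem_Ioi]; positivity⟩
      exact tendsto_const_nhds.div_atTop (tendsto_pow_atTop_atTop_of_one_lt one_lt_two)
    have hl := hp (l := atTop) (fun _ => p) (fun k : ℕ => r / 2 ^ k) hto
      (Eventually.of_forall fun k => by
        rw [one_mul]
        exact mem_closedBall_self (by positivity))
    obtain ⟨k, hk⟩ := (hl.eventually (lt_mem_nhds
      (show (2 : ℝ≥0∞)⁻¹ < 1 by simp))).exists
    refine ⟨k, ?_⟩
    have h0 : 0 < r / 2 ^ k := by positivity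
    have hu := hcb p _ Set.univ h0
    rw [univ_inter, univ_inter] at hu
    rw [hcb p _ G h0, hu] at hk
    rw [ENNReal.lt_div_iff_mul_lt (Or.inl (hpos p _ h0))
      (Or.inl (hbf _ isBounded_ball).ne), mul_comm, ← div_eq_mul_inv] at hk
    rw [mul_comm]
    exact (ENNReal.div_lt_iff (Or.inl two_ne_zero) (Or.inl ENNReal.ofNat_ne_top)).1 hk
  set G' := {p ∈ G | ∃ k : ℕ, m (ball p (r / 2 ^ k)) < 2 * m (G ∩ ball p (r / 2 ^ k))}
  have hGG' : m G ≤ m G' := by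
    rw [ae_restrict_iff' hG] at hae
    refine measure_mono_ae ?_
    filter_upwards [hae] with p hp hpG
    exact ⟨hpG, hp hpG⟩
  have hrad : ∀ p, ∃ j : ℕ, p ∈ G' → m (G ∩ ball p (r / 2 ^ j)) ≤ m (ball p (r / 2 ^ j) \ G) ∧
      m (ball p (r / 2 ^ j)) ≤ C * (2 * m (G ∩ ball p (r / 2 ^ j))) ∧
      m (ball x r) ≤ C ^ (j + 1) * m (ball p (r / 2 ^ j)) := by
    intro p
    by_cases hp : p ∈ G'
    · obtain ⟨j, hj⟩ := exists_stopping_radius hd hr (by linarith) hG hGx hGt hp.1 hsmall hp.2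
      exact ⟨j, fun _ => hj⟩
    · exact ⟨0, fun h => absurd h hp⟩
  choose j hj using hrad
  set ρ : X → ℝ := fun p => r / 2 ^ j p with hρdef
  have hρ0 : ∀ p, 0 < ρ p := fun p => by positivity
  have hρr : ∀ p, ρ p ≤ r := fun p => div_le_self hr.le (one_le_pow₀ one_le_two)
  have hρρm : ∀ p ∈ G', ρ p ≤ ρm := by
    intro p hp
    obtain ⟨-, h2, h3⟩ := hj p hp
    refine hρm (j p) (h3.trans ?_)
    calc C ^ (j p + 1) * m (ball p (r / 2 ^ j p)) ≤ C ^ (j p + 1) * (C * (2 * m G)) := by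
          gcongr
          refine h2.trans ?_
          gcongr
          exact inter_subset_left
      _ = _ := by ring
  obtain ⟨u, hu, hdis, hcov⟩ := Vitali.exists_disjoint_subfamily_covering_enlargement_closedBall
    G' id (fun p => lam * ρ p) (lam * r) (fun p _ => by gcongr; exact hρr p) 4 (by norm_num)
  have hlρ : ∀ p, ρ p ≤ lam * ρ p := fun p => le_mul_of_one_le_left (hρ0 p).le hlam
  have hcount : u.Countable := hdis.countable_of_nonempty_interior fun p _ =>
    ⟨p, ball_subset_interior_closedBall (mem_ball_self ((hρ0 p).trans_le (hlρ p)))⟩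
  have hsum : ∑' p : u, m (G ∩ ball (p : X) (ρ p)) ≤
      2 * (ENNReal.ofReal (C_P 1 * ρm) * Per m G Set.univ) := by
    rw [ENNReal.tsum_eq_iSup_sum]
    refine iSup_le fun F => ?_
    have := sum_measure_inter_ball_le hlam hP hCP hbf hpos hG (F.map (Function.Embedding.subtype _))
      ρ (ρm := ρm) (fun p _ => hρ0 p) (fun p _ => (hρr p).trans_lt hr1) ?_ ?_ ?_
    · simpa using this
    · intro p hp
      obtain ⟨q, -, rfl⟩ := Finset.mem_map.1 hp
      exact hρρm _ (hu q.2)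
    · refine hdis.subset fun p hp => ?_
      obtain ⟨q, -, rfl⟩ := Finset.mem_map.1 hp
      exact q.2
    · intro p hp
      obtain ⟨q, -, rfl⟩ := Finset.mem_map.1 hp
      exact (hj _ (hu q.2)).1
  have hmain : m G' ≤ C ^ k * (C * 2) * ∑' p : u, m (G ∩ ball (p : X) (ρ p)) := by
    calc m G' ≤ m (⋃ p ∈ u, ball p (2 ^ k * ρ p)) := by
          refine measure_mono fun p hp => ?_
          obtain ⟨b, hb, hpb⟩ := hcov p hp
          have h1 := hpb (mem_closedBall_self ((hρ0 p).le.trans (hlρ p)))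
          refine mem_iUnion₂.2 ⟨b, hb, ?_⟩
          rw [mem_closedBall] at h1
          rw [mem_ball]
          refine h1.trans_lt ?_
          rw [← mul_assoc]
          exact mul_lt_mul_of_pos_right hk (hρ0 b)
      _ ≤ ∑' p : u, m (ball (p : X) (2 ^ k * ρ p)) := measure_biUnion_le m hcount _
      _ ≤ ∑' p : u, C ^ k * (C * 2) * m (G ∩ ball (p : X) (ρ p)) := by
          refine ENNReal.tsum_le_tsum fun p => ?_
          have h1 := hd.iterate (R := R) (p : X) (hρ0 p) k
            (mul_le_of_le_one_right (by positivity) ((hρr p).trans hr1.le))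
          refine h1.trans ?_
          rw [mul_assoc, mul_assoc]
          exact mul_le_mul_right (hj _ (hu p.2)).2.1 _
      _ = _ := ENNReal.tsum_mul_left
  calc m G ≤ C ^ k * (C * 2) * (2 * (ENNReal.ofReal (C_P 1 * ρm) * Per m G Set.univ)) :=
        hGG'.trans (hmain.trans (mul_le_mul_right hsum _))
    _ ≤ ENNReal.ofReal (D + 1) * (2 * (ENNReal.ofReal (C_P 1 * ρm) * Per m G Set.univ)) := by
        gcongr
        rw [← ENNReal.ofReal_toReal hDt]
        exact ENNReal.ofReal_le_ofReal (by linarith)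
    _ = _ := by
        rw [show (D + 1) * 2 * C_P 1 * ρm = (D + 1) * (2 * (C_P 1 * ρm)) by ring,
          ENNReal.ofReal_mul (p := D + 1) (by positivity), ENNReal.ofReal_mul (p := 2) two_pos.le,
          ENNReal.ofReal_ofNat]
        ring

end Isoperimetric

section Cutoff

/-- The Lipschitz cutoff function which vanishes where `ψ ≤ a` and equals `1` where
`a + h ≤ ψ`. -/
def cutoff (ψ : X → ℝ) (a h : ℝ) (p : X) : ℝ := max 0 (min 1 (h⁻¹ * (ψ p - a)))

lemma cutoff_mem_Icc (ψ : X → ℝ) (a h : ℝ) (p : X) : cutoff ψ a h p ∈ Set.Icc (0 : ℝ) 1 :=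
  ⟨le_max_left _ _, max_le zero_le_one (min_le_left _ _)⟩

lemma cutoff_eq_zero {ψ : X → ℝ} {a h : ℝ} (hh : 0 < h) {p : X} (hp : ψ p ≤ a) :
    cutoff ψ a h p = 0 :=
  max_eq_left ((min_le_right _ _).trans
    (mul_nonpos_of_nonneg_of_nonpos (inv_nonneg.2 hh.le) (sub_nonpos.2 hp)))

lemma cutoff_eq_one {ψ : X → ℝ} {a h : ℝ} (hh : 0 < h) {p : X} (hp : a + h ≤ ψ p) :
    cutoff ψ a h p = 1 := by
  have : 1 ≤ h⁻¹ * (ψ p - a) := by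
    rw [← inv_mul_cancel₀ hh.ne']
    gcongr
    linarith
  rw [cutoff, min_eq_left this, max_eq_right zero_le_one]

lemma lipschitzWith_cutoff [MetricSpace X] {ψ : X → ℝ} (hψ : LipschitzWith 1 ψ) (a h : ℝ) :
    LipschitzWith ‖h⁻¹‖₊ (cutoff ψ a h) := by
  have h1 : LipschitzWith ‖h⁻¹‖₊ fun p => h⁻¹ * (ψ p - a) := by
    have h2 : LipschitzWith 1 fun p => ψ p - a :=
      LipschitzWith.of_dist_le_mul fun p q => by
        simpa using hψ.dist_le_mul p q
    have h3 := (lipschitzWith_smul (β := ℝ) h⁻¹).comp h2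
    rw [mul_one] at h3
    exact h3
  exact (h1.const_min 1).const_max 0

lemma indicator_one_mem_Icc (E : Set X) (p : X) :
    E.indicator (fun _ => (1 : ℝ)) p ∈ Set.Icc (0 : ℝ) 1 := by
  by_cases hp : p ∈ E <;> simp [hp]

lemma measurable_indicator_one [MeasurableSpace X] {E : Set X} (hE : MeasurableSet E) :
    Measurable (E.indicator fun _ => (1 : ℝ)) := measurable_const.indicator hE

lemma exists_pos_small {D : ℝ} {ε : ℝ≥0∞} (hε : ε ≠ 0) {P : ℝ → Prop}
    (hP : ∀ᶠ h in 𝓝[>] (0 : ℝ), P h) : ∃ h > 0, P h ∧ ENNReal.ofReal (D * h) ≤ ε := by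
  have h1 : Tendsto (fun h : ℝ => ENNReal.ofReal (D * h)) (𝓝[>] 0) (𝓝 0) := by
    have : Continuous fun h : ℝ => ENNReal.ofReal (D * h) :=
      ENNReal.continuous_ofReal.comp (continuous_const_mul D)
    simpa using (this.tendsto 0).mono_left nhdsWithin_le_nhds
  obtain ⟨h, ⟨h2, h3⟩, h4⟩ := ((hP.and (h1.eventually (gt_mem_nhds (pos_iff_ne_zero.2 hε)))).and
    self_mem_nhdsWithin).exists
  exact ⟨h, h4, h2, h3.le⟩

lemma exists_ball_subset_of_closedBall_subset [MetricSpace X] [ProperSpace X] {y : X} {δ : ℝ} {Ω : Set X}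
    (hΩ : IsOpen Ω) (h : closedBall y δ ⊆ Ω) : ∃ ρ > δ, ball y ρ ⊆ Ω := by
  have hK : IsCompact (closedBall y (δ + 1) \ Ω) := (isCompact_closedBall _ _).diff hΩ
  rcases (closedBall y (δ + 1) \ Ω).eq_empty_or_nonempty with he | hne
  · exact ⟨δ + 1, by linarith, ball_subset_closedBall.trans (sdiff_eq_empty.1 he)⟩
  · obtain ⟨q, hq, hmin⟩ := hK.exists_isMinOn hne
      (f := fun p => dist p y) (continuous_id.dist continuous_const).continuousOn
    refine ⟨dist q y, ?_, fun p hp => ?_⟩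
    · by_contra hle
      exact hq.2 (h (not_lt.1 hle))
    · by_contra hpΩ
      have hp1 : p ∈ closedBall y (δ + 1) := (mem_ball.1 hp).le.trans (mem_closedBall.1 hq.1)
      exact absurd (mem_ball.1 hp) (not_lt.2 (hmin ⟨hp1, hpΩ⟩))

end Cutoff

section Integral

variable [MeasurableSpace X] {m : Measure X}

lemma lintegral_abs_sub_indicator_le {E T : Set X} (hE : MeasurableSet E) (hT : MeasurableSet T)
    {g f : X → ℝ} (h0 : ∀ p ∉ E ∩ T, g p = f p) (h1 : ∀ p, |g p - f p| ≤ 1) (K : Set X) :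
    ∫⁻ p in K, ENNReal.ofReal |g p - f p| ∂m ≤ m (T ∩ E) := by
  calc ∫⁻ p in K, ENNReal.ofReal |g p - f p| ∂m ≤ ∫⁻ p, ENNReal.ofReal |g p - f p| ∂m :=
        setLIntegral_le_lintegral _ _
    _ ≤ ∫⁻ p, (T ∩ E).indicator 1 p ∂m := by
        refine lintegral_mono fun p => ?_
        by_cases hp : p ∈ T ∩ E
        · rw [indicator_of_mem hp, Pi.one_apply, ← ENNReal.ofReal_one]
          exact ENNReal.ofReal_le_ofReal (h1 p)
        · rw [h0 p (inter_comm T E ▸ hp)]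
          simp
    _ = m (T ∩ E) := by rw [lintegral_indicator_one (hT.inter hE)]

lemma lintegral_abs_indicator_one {E : Set X} (hE : MeasurableSet E) (T : Set X) :
    ∫⁻ p in T, ENNReal.ofReal |E.indicator (fun _ => (1 : ℝ)) p - 0| ∂m = m (E ∩ T) := by
  rw [← Measure.restrict_apply hE, ← lintegral_indicator_one hE]
  refine lintegral_congr fun p => ?_
  by_cases hp : p ∈ E <;> simp [hp]

end Integral

section Localization

lemma le_totVar [MetricSpace X] [MeasurableSpace X] {m : Measure X} {f : X → ℝ} {B : Set X} {c : ℝ≥0∞}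
    (h : ∀ Ω, IsOpen Ω → B ⊆ Ω → c ≤ totVar m f Ω) : c ≤ totVar m f B := by
  refine le_of_forall_gt fun d hd => ?_
  obtain ⟨Ω, hΩ, hB, hlt⟩ := exists_open_totVar_lt hd
  exact (h Ω hΩ hB).trans_lt hlt

variable [MetricSpace X] [MeasurableSpace X] [BorelSpace X] {m : Measure X}

lemma totVar_zero [ProperSpace X] {Ω : Set X} (hΩ : IsOpen Ω) :
    totVar m (fun _ : X => (0 : ℝ)) Ω = 0 := by
  refine le_antisymm (totVar_le_of_approx hΩ fun K _ _ ε _ => ⟨fun _ => 0, ?_, ?_, ?_⟩) zero_le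
  · exact fun p _ => ⟨1, one_pos, 0, (LipschitzWith.const 0).lipschitzOnWith⟩
  · simp
  · have : mSlope (fun _ : X => (0 : ℝ)) = fun _ => 0 := by
      funext p
      simpa [mSlope, slopeOn] using limsup_const_bot (β := X) (α := ℝ≥0∞)
    simp [this]

lemma totVar_cutoff_le [ProperSpace X] {f g ψ : X → ℝ} (hf : Measurable f) (hg : Measurable g)
    (hψ : LipschitzWith 1 ψ) {a h : ℝ} (hh : 0 < h) {U₁ U₂ W T : Set X} (hU₁ : IsOpen U₁)
    (hU₂ : IsOpen U₂) (hW : IsOpen W) (hWU₁ : ∀ p ∈ W, a ≤ ψ p → p ∈ U₁)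
    (hWU₂ : ∀ p ∈ W, ψ p ≤ a + h → p ∈ U₂) (hT : IsCompact T)
    (hWT : ∀ p ∈ W, a ≤ ψ p → ψ p ≤ a + h → p ∈ T) (hTU₁ : T ⊆ U₁) (hTU₂ : T ⊆ U₂) :
    totVar m (fun p => cutoff ψ a h p * f p + (1 - cutoff ψ a h p) * g p) W ≤
      totVar m f U₁ + totVar m g U₂ +
        ENNReal.ofReal h⁻¹ * ∫⁻ p in T, ENNReal.ofReal |f p - g p| ∂m := by
  have hL : ENNReal.ofReal h⁻¹ = (‖h⁻¹‖₊ : ℝ≥0∞) :=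
    (Real.enorm_eq_ofReal (inv_nonneg.2 hh.le)).symm
  rw [hL]
  refine totVar_glue_le hf hg (lipschitzWith_cutoff hψ a h) (cutoff_mem_Icc ψ a h) hU₁ hU₂ hW
    (isClosed_le continuous_const hψ.continuous) (isClosed_le hψ.continuous continuous_const)
    (fun p hp => cutoff_eq_zero hh (not_le.1 hp).le)
    (fun p hp => cutoff_eq_one hh (not_le.1 hp).le)
    (fun p hp => hWU₁ p hp.1 hp.2) (fun p hp => hWU₂ p hp.1 hp.2) hT
    (fun p hp => hWT p hp.1 hp.2.1 hp.2.2) hTU₁ hTU₂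

lemma totVar_le_add_of_cutoff [ProperSpace X] {f ψ : X → ℝ} (hf : Measurable f)
    (hψ : LipschitzWith 1 ψ) {a h : ℝ} (hh : 0 < h) {U₁ U₂ W T : Set X} (hU₁ : IsOpen U₁)
    (hU₂ : IsOpen U₂) (hW : IsOpen W) (hWU₁ : ∀ p ∈ W, a ≤ ψ p → p ∈ U₁)
    (hWU₂ : ∀ p ∈ W, ψ p ≤ a + h → p ∈ U₂) (hT : IsCompact T)
    (hWT : ∀ p ∈ W, a ≤ ψ p → ψ p ≤ a + h → p ∈ T) (hTU₁ : T ⊆ U₁) (hTU₂ : T ⊆ U₂) :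
    totVar m f W ≤ totVar m f U₁ + totVar m f U₂ := by
  have := totVar_cutoff_le (m := m) hf hf hψ hh hU₁ hU₂ hW hWU₁ hWU₂ hT hWT hTU₁ hTU₂
  simpa [← add_mul] using this

lemma totVar_union_le [ProperSpace X] {f : X → ℝ} (hf : Measurable f) {K₁ K₂ : Set X}
    (hK₁ : IsCompact K₁) (hK₂ : IsCompact K₂) :
    totVar m f (K₁ ∪ K₂) ≤ totVar m f K₁ + totVar m f K₂ := by
  rcases K₁.eq_empty_or_nonempty with rfl | hne
  · simp
  rw [← tsub_le_iff_right]
  refine le_totVar fun U hU hKU => ?_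
  rw [tsub_le_iff_right, ← tsub_le_iff_left]
  refine le_totVar fun V hV hKV => ?_
  rw [tsub_le_iff_left, add_comm]
  obtain ⟨η, hη, hηU⟩ := hK₁.exists_cthickening_subset_open hU hKU
  obtain ⟨ζ, hζ, hζV⟩ := hK₂.exists_cthickening_subset_open hV hKV
  have hmem : ∀ p, infDist p K₁ ≤ η → p ∈ U := fun p hp => by
    obtain ⟨q, hq, hpq⟩ := hK₁.exists_infDist_eq_dist hne p
    exact hηU (mem_cthickening_of_dist_le p q η K₁ hq (hpq ▸ hp))
  refine (totVar_mono m f (B := {p | infDist p K₁ < η / 2} ∪ thickening ζ K₂) ?_).trans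
    (totVar_le_add_of_cutoff (ψ := fun p => infDist p K₁) (a := η / 2) (h := η / 2)
      (T := {p | infDist p K₁ ≤ η} ∩ cthickening ζ K₂) hf (lipschitz_infDist_pt K₁) (by positivity)
      hV hU ?_ ?_ ?_ ?_ ?_ ?_ ?_)
  · refine union_subset_union (fun p hp => ?_) (self_subset_thickening hζ K₂)
    simp only [Set.mem_ofPred_eq, infDist_zero_of_mem hp]
    positivity
  · exact (isOpen_lt (continuous_infDist_pt K₁) continuous_const).union isOpen_thickening
  · rintro p (hp | hp) ha
    · exact absurd hp (not_lt.2 ha)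
    · exact hζV (thickening_subset_cthickening _ _ hp)
  · intro p _ hp
    exact hmem p (by linarith)
  · exact hK₂.cthickening.inter_left (isClosed_le (continuous_infDist_pt K₁) continuous_const)
  · rintro p (hp | hp) ha hp2
    · exact absurd hp (not_lt.2 ha)
    · exact ⟨by simp only [Set.mem_ofPred_eq]; linarith, thickening_subset_cthickening _ _ hp⟩
  · exact fun p hp => hζV hp.2
  · exact fun p hp => hmem p hp.1

lemma totVar_add_le_union {f : X → ℝ} {K₁ K₂ : Set X} (hK₁ : IsCompact K₁) (hK₂ : IsCompact K₂)
    (hd : Disjoint K₁ K₂) : totVar m f K₁ + totVar m f K₂ ≤ totVar m f (K₁ ∪ K₂) := by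
  refine le_totVar fun Ω hΩ hK => ?_
  obtain ⟨U, V, hU, hV, hKU, hKV, hUV⟩ := SeparatedNhds.of_isCompact_isCompact hK₁ hK₂ hd
  calc totVar m f K₁ + totVar m f K₂ ≤ totVar m f (U ∩ Ω) + totVar m f (V ∩ Ω) :=
        add_le_add (totVar_mono m f (subset_inter hKU (subset_union_left.trans hK)))
          (totVar_mono m f (subset_inter hKV (subset_union_right.trans hK)))
    _ ≤ totVar m f Ω := totVar_add_le_of_disjoint (hU.inter hΩ) (hV.inter hΩ) hΩ
        inter_subset_right inter_subset_right (hUV.mono inter_subset_left inter_subset_left)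

lemma totVar_congr_of_subset_open [ProperSpace X] {f g : X → ℝ} {B V : Set X} (hV : IsOpen V)
    (hBV : B ⊆ V) (h : Set.EqOn f g V) : totVar m f B ≤ totVar m g B := by
  refine le_totVar fun Ω hΩ hB => ?_
  calc totVar m f B ≤ totVar m f (Ω ∩ V) := totVar_mono m f (subset_inter hB hBV)
    _ ≤ totVar m g (Ω ∩ V) := totVar_congr (hΩ.inter hV) (h.mono inter_subset_right)
    _ ≤ totVar m g Ω := totVar_mono m g inter_subset_left

lemma HasLocFinPer.lt_top_of_isCompact [ProperSpace X] {E : Set X} (hE : MeasurableSet E)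
    (hP : HasLocFinPer m E) {K : Set X} (hK : IsCompact K) : Per m E K < ∞ := by
  obtain ⟨K', -, hKK', hlt⟩ : ∃ K', IsCompact K' ∧ K ⊆ K' ∧ Per m E K' < ∞ := by
    refine hK.induction_on (p := fun s => ∃ K', IsCompact K' ∧ s ⊆ K' ∧ Per m E K' < ∞)
      ?_ ?_ ?_ ?_
    · refine ⟨∅, isCompact_empty, Subset.rfl, ?_⟩
      calc Per m E ∅ ≤ totVar m (fun _ : X => (0 : ℝ)) ∅ := totVar_congr isOpen_empty (eqOn_empty _ _)
        _ < ∞ := by simp [totVar_zero isOpen_empty]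
    · rintro s t hst ⟨K', h1, h2, h3⟩
      exact ⟨K', h1, hst.trans h2, h3⟩
    · rintro s t ⟨K₁, h1, h2, h3⟩ ⟨K₂, h1', h2', h3'⟩
      exact ⟨K₁ ∪ K₂, h1.union h1', union_subset_union h2 h2',
        (totVar_union_le (measurable_indicator_one hE) h1 h1').trans_lt (ENNReal.add_lt_top.2 ⟨h3, h3'⟩)⟩
    · intro p _
      obtain ⟨r, hr, hlt⟩ := hP p
      exact ⟨closedBall p (r / 2), mem_nhdsWithin_of_mem_nhds (closedBall_mem_nhds p (by positivity)),
        _, isCompact_closedBall _ _, Subset.rfl,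
        (totVar_mono m _ (closedBall_subset_ball (by linarith))).trans_lt hlt⟩
  exact (totVar_mono m _ hKK').trans_lt hlt

/-- Adding a small ball around `y` to `E` increases the perimeter in a larger concentric closed
ball by a controlled amount. -/
lemma DeformIneq.per_union_closedBall_le [ProperSpace X] {E : Set X} (hE : MeasurableSet E)
    (hP : HasLocFinPer m E) {y : X} {R C : ℝ} (h : DeformIneq m E y R C) {s δ : ℝ} (hs : 0 < s)
    (hsδ : s < δ) (hδR : δ < R) :
    Per m (E ∪ ball y s) (closedBall y δ) ≤
      ENNReal.ofReal C * m (ball y s \ E) / ENNReal.ofReal s + Per m E (closedBall y δ) := by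
  set Q := ENNReal.ofReal C * m (ball y s \ E) / ENNReal.ofReal s
  rw [← tsub_le_iff_left]
  refine le_totVar fun Ω hΩ hδΩ => ?_
  obtain ⟨ρ₀, hρ₀, hρ₀Ω⟩ := exists_ball_subset_of_closedBall_subset hΩ hδΩ
  obtain ⟨ρ', hρ', hρ'R, hρ'Ω⟩ : ∃ ρ' > δ, ρ' ≤ R ∧ ball y ρ' ⊆ Ω :=
    ⟨min ρ₀ R, lt_min hρ₀ hδR, min_le_right _ _,
      (ball_subset_ball (min_le_left _ _)).trans hρ₀Ω⟩
  rw [tsub_le_iff_left]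
  refine le_trans ?_ (add_le_add_right (totVar_mono m _ hρ'Ω) Q)
  change Per m (E ∪ ball y s) (closedBall y δ) ≤ Q + Per m E (ball y ρ')
  set ρ := (δ + ρ') / 2 with hρ
  have hδρ : δ < ρ := by linarith
  have hρρ' : ρ < ρ' := by linarith
  set V := ball y (2 * R) \ closedBall y ρ
  have hV : IsOpen V := isOpen_ball.sdiff isClosed_closedBall
  have hfin : Per m E V ≠ ∞ := by
    refine ((totVar_mono m _ ?_).trans_lt
      (hP.lt_top_of_isCompact hE (isCompact_closedBall y (2 * R)))).ne
    exact sdiff_subset.trans ball_subset_closedBall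
  have h1 : Per m (E ∪ ball y s) (closedBall y δ) + Per m E V ≤
      Per m (E ∪ ball y s) (ball y (2 * R)) := by
    calc _ ≤ Per m (E ∪ ball y s) (ball y ρ) + Per m (E ∪ ball y s) V := by
          refine add_le_add (totVar_mono m _ (closedBall_subset_ball hδρ)) (totVar_congr hV ?_)
          intro p hp
          have hps : p ∉ ball y s := fun hps => hp.2 (by
            rw [mem_closedBall]; rw [mem_ball] at hps; linarith)
          by_cases hpE : p ∈ E <;> simp [hpE, hps]
      _ ≤ _ := totVar_add_le_of_disjoint isOpen_ball hV isOpen_ball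
          (ball_subset_ball (by linarith)) sdiff_subset
          (disjoint_left.2 fun p hp hpV => hpV.2 (ball_subset_closedBall hp))
  have h2 : Per m E (ball y (2 * R)) ≤ Per m E V + Per m E (ball y ρ') := by
    refine totVar_le_add_of_cutoff (ψ := fun p => dist p y) (a := ρ + (ρ' - ρ) / 3)
      (h := (ρ' - ρ) / 3)
      (T := {p | ρ + (ρ' - ρ) / 3 ≤ dist p y} ∩ closedBall y (ρ + (ρ' - ρ) / 3 + (ρ' - ρ) / 3))
      (measurable_indicator_one hE) (LipschitzWith.dist_left y) (by linarith) hV isOpen_ball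
      isOpen_ball ?_ ?_ ?_ ?_ ?_ ?_
    · exact fun p hp hpa => ⟨hp, by rw [mem_closedBall]; linarith⟩
    · exact fun p hp hpa => by rw [mem_ball]; linarith
    · exact (isCompact_closedBall _ _).inter_left
        (isClosed_le continuous_const (continuous_id.dist continuous_const))
    · exact fun p _ h1 h2 => ⟨h1, h2⟩
    · rintro p ⟨hp1, hp2⟩
      rw [mem_closedBall] at hp2
      rw [Set.mem_ofPred_eq] at hp1
      exact ⟨by rw [mem_ball]; linarith, by rw [mem_closedBall]; linarith⟩
    · rintro p ⟨hp1, hp2⟩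
      rw [mem_closedBall] at hp2
      rw [mem_ball]; linarith
  have h3 := (h y (mem_ball_self (by linarith)) s ⟨hs, hsδ.trans hδR⟩).2
  have h4 : Per m E V + Per m (E ∪ ball y s) (closedBall y δ) ≤
      Per m E V + (Q + Per m E (ball y ρ')) := by
    calc _ ≤ Q + (Per m E V + Per m E (ball y ρ')) := by
          rw [add_comm]
          exact h1.trans (h3.trans (add_le_add_right h2 _))
      _ = _ := by ring
  exact (ENNReal.add_le_add_iff_left hfin).1 h4

/-- Removing a small closed ball around `x` from `E`: the new perimeter created on the sphere is
controlled by the upper right growth rate `D` of the volume of `E` in balls centred at `x`. -/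
lemma per_sdiff_closedBall_add_le [ProperSpace X] {E : Set X} (hE : MeasurableSet E) {x : X}
    {r' r δ D : ℝ} (hr' : r' < r) (hrδ : r < δ)
    (hD : ∀ᶠ h in 𝓝[>] (0 : ℝ),
      m ((closedBall x (r + h) \ ball x r) ∩ E) ≤ ENNReal.ofReal (D * h)) :
    Per m (E \ closedBall x r) (closedBall x δ) + Per m E (ball x r') ≤
      Per m E (closedBall x δ) + ENNReal.ofReal D := by
  rw [← tsub_le_iff_right]
  refine le_totVar fun Ω hΩ hδΩ => ?_
  obtain ⟨ρ, hρ, hρΩ⟩ := exists_ball_subset_of_closedBall_subset hΩ hδΩ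
  rw [tsub_le_iff_right]
  refine le_trans ?_ (add_le_add_left (totVar_mono m _ hρΩ) _)
  set V := ball x ρ \ closedBall x r'
  have hV : IsOpen V := isOpen_ball.sdiff isClosed_closedBall
  have h1 : Per m (E \ closedBall x r) (ball x ρ) ≤ Per m E V + ENNReal.ofReal D := by
    refine totVar_le_of_lsc (measurable_indicator_one (hE.diff isClosed_closedBall.measurableSet))
      isOpen_ball fun K _ _ ε hε => ?_
    obtain ⟨h, hh, ⟨hDh, hhδ⟩, hsmall⟩ := exists_pos_small (D := D) hε
      (hD.and (Ioo_mem_nhdsGT (show (0 : ℝ) < ρ - r by linarith)))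
    set φ := cutoff (fun p => dist p x) r h
    have hφ := cutoff_mem_Icc (fun p => dist p x) r h
    set χ := E.indicator fun _ => (1 : ℝ)
    set T := closedBall x (r + h) \ ball x r
    have hT : IsCompact T := (isCompact_closedBall _ _).diff isOpen_ball
    have hφc : Continuous φ := (lipschitzWith_cutoff (LipschitzWith.dist_left x) r h).continuous
    refine ⟨fun p => φ p * χ p + (1 - φ p) * 0, ?_, ?_, ?_⟩
    · exact (hφc.measurable.mul (measurable_indicator_one hE)).add
        ((measurable_const.sub hφc.measurable).mul measurable_const)
    · refine (lintegral_abs_sub_indicator_le hE hT.measurableSet (fun p hp => ?_)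
        (fun p => ?_) K).trans (hDh.trans hsmall)
      · by_cases hpE : p ∈ E
        · have hpT : p ∉ T := fun h => hp ⟨hpE, h⟩
          rcases lt_or_ge (dist p x) r with hpr | hpr
          · rw [show φ p = 0 from cutoff_eq_zero hh hpr.le, indicator_of_notMem]
            · simp
            · exact fun h => h.2 hpr.le
          · have hpr2 : r + h < dist p x := by
              by_contra hc
              exact hpT ⟨not_lt.1 hc, fun h => absurd hpr (not_le.2 h)⟩
            rw [show φ p = 1 from cutoff_eq_one hh hpr2.le, indicator_of_mem]
            · simp [χ, hpE]
            · exact ⟨hpE, fun h => by rw [mem_closedBall] at h; linarith⟩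
        · simp [χ, hpE]
      · have h1 := hφ p
        have h2 := indicator_one_mem_Icc E p
        have h3 := indicator_one_mem_Icc (E \ closedBall x r) p
        rw [abs_le]
        constructor <;> nlinarith [h1.1, h1.2, h2.1, h2.2, h3.1, h3.2]
    · have hglue := totVar_cutoff_le (m := m) (ψ := fun p => dist p x) (a := r) (h := h) (U₁ := V)
        (U₂ := Set.univ) (W := ball x ρ) (T := T) (measurable_indicator_one hE)
        (measurable_const (a := (0 : ℝ))) (LipschitzWith.dist_left x) hh hV isOpen_univ isOpen_ball
        (fun p hp hpr => ⟨hp, fun h => by rw [mem_closedBall] at h; linarith⟩)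
        (fun _ _ _ => mem_univ _) hT (fun p _ h1 h2 => ⟨h2, fun h => absurd h1 (not_le.2 h)⟩)
        (fun p hp => ⟨?_, fun h => hp.2 ?_⟩) (subset_univ _)
      · refine hglue.trans ?_
        rw [totVar_zero isOpen_univ, add_zero, add_assoc]
        refine add_le_add_right (le_add_right ?_) _
        calc ENNReal.ofReal h⁻¹ * ∫⁻ p in T, ENNReal.ofReal |χ p - 0| ∂m
            ≤ ENNReal.ofReal h⁻¹ * ENNReal.ofReal (D * h) := by
              gcongr
              rw [lintegral_abs_indicator_one hE, inter_comm]
              exact hDh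
          _ = ENNReal.ofReal D := by
              rw [← ENNReal.ofReal_mul (inv_nonneg.2 hh.le)]
              congr 1
              field_simp
      · have := hp.1
        rw [mem_closedBall] at this
        rw [mem_ball]
        linarith [hhδ.2]
      · rw [mem_closedBall] at h
        rw [mem_ball]
        linarith
  calc Per m (E \ closedBall x r) (closedBall x δ) + Per m E (ball x r')
      ≤ Per m E V + ENNReal.ofReal D + Per m E (ball x r') :=
        add_le_add_left ((totVar_mono m _ (closedBall_subset_ball hρ)).trans h1) _
    _ = Per m E V + Per m E (ball x r') + ENNReal.ofReal D := by ring
    _ ≤ Per m E (ball x ρ) + ENNReal.ofReal D := by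
        refine add_le_add_left (totVar_add_le_of_disjoint hV isOpen_ball isOpen_ball sdiff_subset
          (ball_subset_ball (by linarith)) ?_) _
        exact disjoint_left.2 fun p hpV hp => hpV.2 (ball_subset_closedBall hp)

/-- Intersecting `E` with a ball: the new perimeter created on the sphere is controlled by the lower
left growth rate `D` of the volume of `E` in concentric balls. -/
lemma per_inter_ball_le [ProperSpace X] {E : Set X} (hE : MeasurableSet E) {x : X} {r D : ℝ}
    {M : ℝ≥0∞} (hM : ∀ r' < r, Per m E (ball x r') ≤ M)
    (hD : ∀ᶠ h in 𝓝[>] (0 : ℝ),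
      m ((ball x r \ ball x (r - h)) ∩ E) ≤ ENNReal.ofReal (D * h)) :
    Per m (E ∩ ball x r) Set.univ ≤ M + ENNReal.ofReal (2 * D) := by
  refine totVar_le_of_lsc (measurable_indicator_one (hE.inter isOpen_ball.measurableSet))
    isOpen_univ fun K _ _ ε hε => ?_
  obtain ⟨t, ht, hDt, hsmall⟩ := exists_pos_small (D := D) hε hD
  obtain ⟨h, hh, rfl⟩ : ∃ h > 0, t = 2 * h := ⟨t / 2, by positivity, by ring⟩
  set φ := cutoff (fun p => dist p x) (r - 2 * h) h
  have hφ := cutoff_mem_Icc (fun p => dist p x) (r - 2 * h) h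
  set χ := E.indicator fun _ => (1 : ℝ)
  set T := closedBall x (r - h) \ ball x (r - 2 * h)
  have hT : IsCompact T := (isCompact_closedBall _ _).diff isOpen_ball
  have hφc : Continuous φ :=
    (lipschitzWith_cutoff (LipschitzWith.dist_left x) (r - 2 * h) h).continuous
  refine ⟨fun p => φ p * 0 + (1 - φ p) * χ p, ?_, ?_, ?_⟩
  · exact (hφc.measurable.mul measurable_const).add
      ((measurable_const.sub hφc.measurable).mul (measurable_indicator_one hE))
  · refine (lintegral_abs_sub_indicator_le hE
      (isOpen_ball.measurableSet.diff isOpen_ball.measurableSet) (fun p hp => ?_)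
      (fun p => ?_) K).trans (hDt.trans hsmall)
    · by_cases hpE : p ∈ E
      · rcases lt_or_ge (dist p x) (r - 2 * h) with hpr | hpr
        · rw [show φ p = 0 from cutoff_eq_zero hh hpr.le, indicator_of_mem]
          · simp [χ, hpE]
          · exact ⟨hpE, by rw [mem_ball]; linarith⟩
        · have hpr2 : r ≤ dist p x := by
            by_contra hc
            exact hp ⟨hpE, not_le.1 hc, fun h => absurd hpr (not_le.2 h)⟩
          rw [show φ p = 1 from cutoff_eq_one hh (by linarith), indicator_of_notMem]
          · simp
          · exact fun h => absurd hpr2 (not_le.2 h.2)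
      · simp [χ, hpE]
    · have h1 := hφ p
      have h2 := indicator_one_mem_Icc E p
      have h3 := indicator_one_mem_Icc (E ∩ ball x r) p
      rw [abs_le]
      constructor <;> nlinarith [h1.1, h1.2, h2.1, h2.2, h3.1, h3.2]
  · have hglue := totVar_cutoff_le (m := m) (ψ := fun p => dist p x) (a := r - 2 * h) (h := h)
      (U₁ := Set.univ) (U₂ := ball x (r - h / 2)) (W := Set.univ) (T := T)
      (measurable_const (a := (0 : ℝ))) (measurable_indicator_one hE) (LipschitzWith.dist_left x) hh
      isOpen_univ isOpen_ball isOpen_univ (fun _ _ _ => mem_univ _)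
      (fun p _ hp => by rw [mem_ball]; linarith) hT
      (fun p _ h1 h2 => ⟨by rw [mem_closedBall]; linarith, fun h => absurd h1 (not_le.2 h)⟩)
      (subset_univ _) (fun p hp => by
        have := hp.1
        rw [mem_closedBall] at this
        rw [mem_ball]
        linarith)
    refine hglue.trans ?_
    rw [totVar_zero isOpen_univ, zero_add]
    refine le_add_right (add_le_add (hM _ (by linarith)) ?_)
    calc ENNReal.ofReal h⁻¹ * ∫⁻ p in T, ENNReal.ofReal |0 - χ p| ∂m
        ≤ ENNReal.ofReal h⁻¹ * ENNReal.ofReal (D * (2 * h)) := by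
          gcongr
          simp_rw [abs_sub_comm (0 : ℝ)]
          rw [lintegral_abs_indicator_one hE, inter_comm]
          refine (measure_mono ?_).trans hDt
          exact inter_subset_inter_left _
            (sdiff_subset_sdiff_left (closedBall_subset_ball (by linarith)))
      _ = ENNReal.ofReal (2 * D) := by
          rw [← ENNReal.ofReal_mul (inv_nonneg.2 hh.le)]
          congr 1
          field_simp

end Localization

lemma indicator_one_congr {A B : Set X} {p : X} (h : p ∈ A ↔ p ∈ B) :
    A.indicator (fun _ => (1 : ℝ)) p = B.indicator (fun _ => (1 : ℝ)) p := by
  by_cases hp : p ∈ A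
  · rw [indicator_of_mem hp, indicator_of_mem (h.1 hp)]
  · rw [indicator_of_notMem hp, indicator_of_notMem (mt h.2 hp)]

lemma monotone_measureReal_ball_inter [MetricSpace X] [MeasurableSpace X] {m : Measure X}
    (hbf : BoundedlyFinite m) (x : X) (E : Set X) :
    Monotone fun t => (m (ball x t ∩ E)).toReal := fun _ _ h =>
  ENNReal.toReal_mono (measure_ne_top_of_subset inter_subset_left (hbf _ isBounded_ball).ne)
    (measure_mono (inter_subset_inter_left _ (ball_subset_ball h)))

section Minimizer

variable [MetricSpace X] [MeasurableSpace X] [BorelSpace X] {m : Measure X}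

/-- Comparison of a volume-constrained minimizer with the competitor obtained by removing a small
ball around `x` and adding a ball around `y` that restores the volume. -/
lemma VolConstMin.per_inter_ball_le [ProperSpace X] {E : Set X} (hE : VolConstMin m E)
    (hsph : ∀ p (s : ℝ), 0 < s → m (sphere p s) = 0) {x y : X} {δ R C : ℝ}
    (hDef : DeformIneq m E y R C) (hδR : δ < R)
    (hdisj : Disjoint (closedBall x δ) (closedBall y δ)) {r s D : ℝ} (hr : 0 < r) (hrδ : r < δ)
    (hs : 0 < s) (hsδ : s < δ) (hrs : m (ball x r ∩ E) = m (ball y s \ E))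
    (hD : ∀ᶠ h in 𝓝[>] (0 : ℝ),
      m ((closedBall x (r + h) \ ball x r) ∩ E) ≤ ENNReal.ofReal (D * h))
    (hD' : ∀ᶠ h in 𝓝[>] (0 : ℝ),
      m ((ball x r \ ball x (r - h)) ∩ E) ≤ ENNReal.ofReal (D * h)) :
    Per m (E ∩ ball x r) Set.univ ≤
      ENNReal.ofReal C * m (ball y s \ E) / ENNReal.ofReal s + ENNReal.ofReal D +
        ENNReal.ofReal (2 * D) := by
  obtain ⟨hEm, hEP, hmin⟩ := hE
  refine _root_.per_inter_ball_le hEm (fun r' hr' => ?_) hD'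
  set Q := ENNReal.ofReal C * m (ball y s \ E) / ENNReal.ofReal s
  set Bx := closedBall x δ
  set By := closedBall y δ
  have hBx : IsCompact Bx := isCompact_closedBall _ _
  have hBy : IsCompact By := isCompact_closedBall _ _
  have hrB : closedBall x r ⊆ Bx := closedBall_subset_closedBall hrδ.le
  have hsB : closedBall y s ⊆ By := closedBall_subset_closedBall hsδ.le
  set F := (E \ closedBall x r) ∪ ball y s
  have hF : MeasurableSet F :=
    (hEm.diff isClosed_closedBall.measurableSet).union isOpen_ball.measurableSet
  have hxy : ∀ p ∈ Bx, p ∉ By := fun p h h' => disjoint_left.1 hdisj h h'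
  have hvr : m (E ∩ closedBall x r) = m (ball y s \ E) := by
    rw [← hrs]
    refine le_antisymm ?_ (by rw [inter_comm]; exact measure_mono (inter_subset_inter_right _ ball_subset_closedBall))
    calc m (E ∩ closedBall x r) ≤ m ((ball x r ∩ E) ∪ sphere x r) := measure_mono (by
          rw [← ball_union_sphere]
          exact fun q hq => hq.2.imp (fun h => ⟨h, hq.1⟩) id)
      _ ≤ m (ball x r ∩ E) + m (sphere x r) := measure_union_le _ _
      _ = _ := by rw [hsph x r hr, add_zero]
  have hsymm : m ((E ∆ F) \ (Bx ∪ By)) = 0 := by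
    convert measure_empty (μ := m)
    refine eq_empty_of_forall_notMem fun p hp => ?_
    have h1 : p ∉ closedBall x r := fun h => hp.2 (Or.inl (hrB h))
    have h2 : p ∉ ball y s := fun h => hp.2 (Or.inr (hsB (ball_subset_closedBall h)))
    rcases hp.1 with h | h
    · exact h.2 (Or.inl ⟨h.1, h1⟩)
    · exact h.1.elim (fun h' => h.2 h'.1) h2
  have hvol : m (E ∩ (Bx ∪ By)) = m (F ∩ (Bx ∪ By)) := by
    have hunion : ∀ G, MeasurableSet G → m (G ∩ (Bx ∪ By)) = m (G ∩ Bx) + m (G ∩ By) := fun G hG => by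
      rw [inter_union_distrib_left]
      exact measure_union' (hdisj.mono inter_subset_right inter_subset_right)
        (hG.inter hBx.measurableSet)
    have e1 : m (E ∩ Bx) = m (ball y s \ E) + m (F ∩ Bx) := by
      rw [← measure_inter_add_sdiff (E ∩ Bx) (isClosed_closedBall (x := x) (ε := r)).measurableSet,
        ← hvr]
      congr 2
      · rw [inter_assoc, inter_eq_self_of_subset_right hrB]
      · ext p
        refine ⟨fun h => ⟨Or.inl ⟨h.1.1, h.2⟩, h.1.2⟩, fun h => ?_⟩
        rcases h.1 with h' | h'
        · exact ⟨⟨h'.1, h.2⟩, h'.2⟩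
        · exact absurd (hsB (ball_subset_closedBall h')) (hxy p h.2)
    have e2 : m (F ∩ By) = m (E ∩ By) + m (ball y s \ E) := by
      rw [← measure_inter_add_sdiff (F ∩ By) hEm]
      congr 2
      · ext p
        refine ⟨fun h => ⟨h.2, h.1.2⟩, fun h => ⟨⟨Or.inl ⟨h.1, fun h' => ?_⟩, h.2⟩, h.1⟩⟩
        exact hxy p (hrB h') h.2
      · ext p
        refine ⟨fun h => ⟨?_, h.2⟩, fun h =>
          ⟨⟨Or.inr h.1, hsB (ball_subset_closedBall h.1)⟩, h.2⟩⟩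
        exact h.1.1.elim (fun h' => absurd h'.1 h.2) id
    rw [hunion E hEm, hunion F hF, e1, e2]
    ring
  have hmin' := hmin F (Bx ∪ By) hF (hBx.union hBy) hsymm hvol
  have hFx : Per m F Bx ≤ Per m (E \ closedBall x r) Bx := by
    refine totVar_congr_of_subset_open (isClosed_closedBall (x := y) (ε := s)).isOpen_compl
      (fun p hp h => hxy p hp (hsB h)) fun p hp => ?_
    have : p ∉ ball y s := fun h => hp (ball_subset_closedBall h)
    exact indicator_one_congr ⟨fun h => h.resolve_right this, Or.inl⟩
  have hFy : Per m F By ≤ Per m (E ∪ ball y s) By := by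
    refine totVar_congr_of_subset_open (isClosed_closedBall (x := x) (ε := r)).isOpen_compl
      (fun p hp h => hxy p (hrB h) hp) fun p hp => ?_
    have : p ∈ E \ closedBall x r ↔ p ∈ E := and_iff_left hp
    exact indicator_one_congr (or_congr this Iff.rfl)
  have hy := hDef.per_union_closedBall_le hEm hEP hs hsδ hδR
  have hx := per_sdiff_closedBall_add_le hEm hr' hrδ hD
  have hxfin := (hEP.lt_top_of_isCompact hEm hBx).ne
  have hyfin := (hEP.lt_top_of_isCompact hEm hBy).ne
  have h1 : Per m E Bx ≤ Per m (E \ closedBall x r) Bx + Q := by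
    refine (ENNReal.add_le_add_iff_right hyfin).1 ?_
    calc Per m E Bx + Per m E By ≤ Per m E (Bx ∪ By) := totVar_add_le_union hBx hBy hdisj
      _ ≤ Per m F (Bx ∪ By) := hmin'
      _ ≤ Per m F Bx + Per m F By := totVar_union_le (measurable_indicator_one hF) hBx hBy
      _ ≤ Per m (E \ closedBall x r) Bx + (Q + Per m E By) := add_le_add hFx (hFy.trans hy)
      _ = _ := by ring
  refine (ENNReal.add_le_add_iff_left hxfin).1 ?_
  calc Per m E Bx + Per m E (ball x r')
      ≤ Per m (E \ closedBall x r) Bx + Q + Per m E (ball x r') := add_le_add_left h1 _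
    _ = Per m (E \ closedBall x r) Bx + Per m E (ball x r') + Q := by ring
    _ ≤ Per m E Bx + ENNReal.ofReal D + Q := add_le_add_left hx _
    _ = _ := by ring

lemma measure_sdiff_ball_inter_eq (hbf : BoundedlyFinite m) (x : X) {E : Set X}
    (hE : MeasurableSet E) {a b : ℝ} (hab : a ≤ b) :
    m ((ball x b \ ball x a) ∩ E) =
      ENNReal.ofReal ((m (ball x b ∩ E)).toReal - (m (ball x a ∩ E)).toReal) := by
  have hfin : ∀ t, m (ball x t ∩ E) ≠ ∞ := fun t =>
    measure_ne_top_of_subset inter_subset_left (hbf _ isBounded_ball).ne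
  rw [ENNReal.ofReal_sub _ ENNReal.toReal_nonneg, ENNReal.ofReal_toReal (hfin b),
    ENNReal.ofReal_toReal (hfin a), ← measure_sdiff
      (inter_subset_inter_left _ (ball_subset_ball hab))
      (isOpen_ball.measurableSet.inter hE).nullMeasurableSet (hfin a)]
  congr 1
  ext p
  simp only [mem_inter_iff, Set.mem_sdiff]
  tauto

lemma eventually_measure_annulus_le (hbf : BoundedlyFinite m)
    (hsph : ∀ p (s : ℝ), 0 < s → m (sphere p s) = 0) (x : X) {E : Set X} (hE : MeasurableSet E)
    {r V' D : ℝ} (hr : 0 < r)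
    (hV : HasDerivAt (fun t => (m (ball x t ∩ E)).toReal) V' r) (hD : V' < D) :
    (∀ᶠ h in 𝓝[>] (0 : ℝ),
      m ((closedBall x (r + h) \ ball x r) ∩ E) ≤ ENNReal.ofReal (D * h)) ∧
    ∀ᶠ h in 𝓝[>] (0 : ℝ), m ((ball x r \ ball x (r - h)) ∩ E) ≤ ENNReal.ofReal (D * h) := by
  set V := fun t => (m (ball x t ∩ E)).toReal
  have hslope := hasDerivAt_iff_tendsto_slope_zero.1 hV
  have hev := hslope.eventually (gt_mem_nhds hD)
  constructor
  · have h1 := hev.filter_mono (nhdsWithin_mono 0 (fun h (hh : 0 < h) => hh.ne'))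
    filter_upwards [h1, self_mem_nhdsWithin] with h h2 h3
    rw [mem_Ioi] at h3
    calc m ((closedBall x (r + h) \ ball x r) ∩ E)
        ≤ m (((ball x (r + h) \ ball x r) ∩ E) ∪ sphere x (r + h)) := measure_mono (by
          rw [← ball_union_sphere]
          exact fun q hq => hq.1.1.imp (fun h => ⟨⟨h, hq.1.2⟩, hq.2⟩) id)
      _ ≤ m ((ball x (r + h) \ ball x r) ∩ E) + m (sphere x (r + h)) := measure_union_le _ _
      _ = ENNReal.ofReal (V (r + h) - V r) := by
          rw [hsph x _ (by linarith), add_zero, measure_sdiff_ball_inter_eq hbf x hE (by linarith)]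
      _ ≤ _ := by
          refine ENNReal.ofReal_le_ofReal ?_
          rw [smul_eq_mul, inv_mul_lt_iff₀ h3, mul_comm] at h2
          exact h2.le
  · have hneg : Tendsto (fun h : ℝ => -h) (𝓝[>] 0) (𝓝[≠] 0) := by
      refine tendsto_nhdsWithin_iff.2 ⟨?_, ?_⟩
      · simpa using (continuous_neg.tendsto (0 : ℝ)).mono_left nhdsWithin_le_nhds
      · filter_upwards [self_mem_nhdsWithin] with h hh
        exact neg_ne_zero.2 (ne_of_gt hh)
    filter_upwards [hneg.eventually hev, self_mem_nhdsWithin] with h h2 h3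
    rw [mem_Ioi] at h3
    rw [measure_sdiff_ball_inter_eq hbf x hE (by linarith)]
    refine ENNReal.ofReal_le_ofReal ?_
    rw [smul_eq_mul, ← neg_inv, neg_mul, ← mul_neg, inv_mul_lt_iff₀ h3, ← sub_eq_add_neg] at h2
    change V r - V (r - h) ≤ _
    linarith

end Minimizer

lemma Monotone.ofReal_mul_volume_le {f : ℝ → ℝ} (hf : Monotone f) {a b β : ℝ} (hab : a ≤ b)
    {S : Set ℝ} (hS : S ⊆ Ioc a b) (h : ∀ᵐ t, t ∈ S → β ≤ deriv f t) :
    ENNReal.ofReal β * volume S ≤ ENNReal.ofReal (f b - f a) := by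
  have hmono : MonotoneOn f (uIcc a b) := hf.monotoneOn _
  have hint := hmono.intervalIntegrable_deriv
  rw [intervalIntegrable_iff_integrableOn_Ioc_of_le hab] at hint
  have hle : ∫ t in Ioc a b, deriv f t ≤ f b - f a := by
    have := hmono.intervalIntegral_deriv_mem_uIcc
    rw [uIcc_of_le (sub_nonneg.2 (hf hab)), intervalIntegral.integral_of_le hab] at this
    exact this.2
  have hmeas : Measurable fun t => ENNReal.ofReal (deriv f t) := (measurable_deriv f).ennreal_ofReal
  calc ENNReal.ofReal β * volume S
      ≤ ENNReal.ofReal β * (volume.restrict (Ioc a b))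
          {t | ENNReal.ofReal β ≤ ENNReal.ofReal (deriv f t)} := by
        refine mul_le_mul_right ?_ _
        rw [Measure.restrict_apply (measurableSet_le measurable_const hmeas)]
        refine measure_mono_ae ?_
        filter_upwards [h] with t ht hts
        exact ⟨ENNReal.ofReal_le_ofReal (ht hts), hS hts⟩
    _ ≤ ∫⁻ t in Ioc a b, ENNReal.ofReal (deriv f t) := mul_meas_ge_le_lintegral hmeas _
    _ = ENNReal.ofReal (∫ t in Ioc a b, deriv f t) :=
        (ofReal_integral_eq_lintegral_ofReal hint
          (Eventually.of_forall fun t => hf.deriv_nonneg)).symm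
    _ ≤ _ := ENNReal.ofReal_le_ofReal hle

lemma tendsto_toReal_div_of_mem_essExt [MetricSpace X] [MeasurableSpace X] {m : Measure X}
    {E : Set X} {x : X} (hx : x ∈ essExt m E) :
    Tendsto (fun r : ℝ => (m (ball x r ∩ E)).toReal / (m (ball x r)).toReal) (𝓝[>] 0) (𝓝 0) := by
  refine ((ENNReal.tendsto_toReal ENNReal.zero_ne_top).comp hx).congr fun r => ?_
  simp only [Function.comp_apply, ENNReal.toReal_div, inter_comm E]

/-- A ball in which `E` is negligible consists of points of density zero. -/
lemma mem_interior_essExt_of_measure_inter_eq_zero [MetricSpace X] [MeasurableSpace X]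
    {m : Measure X} {E : Set X} {x : X} {r : ℝ} (hr : 0 < r) (h : m (ball x r ∩ E) = 0) :
    x ∈ interior (essExt m E) := by
  refine mem_interior.2 ⟨ball x r, fun z hz => ?_, isOpen_ball, mem_ball_self hr⟩
  have hz' : 0 < r - dist z x := sub_pos.2 hz
  refine tendsto_const_nhds.congr' ?_
  filter_upwards [Ioo_mem_nhdsGT hz'] with t ht
  have hsub : E ∩ ball z t ⊆ ball x r ∩ E := fun p hp =>
    ⟨ball_subset_ball' (by linarith [ht.2]) hp.2, hp.1⟩
  rw [measure_mono_null hsub h, ENNReal.zero_div]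

section VolumeGrowth

variable [MetricSpace X] [MeasurableSpace X] [BorelSpace X] {m : Measure X}

/-- Perimeter bound on small balls in terms of the derivative of the volume function. -/
lemma VolConstMin.per_inter_ball_le_deriv [ProperSpace X] {E : Set X} (hE : VolConstMin m E)
    (hbf : BoundedlyFinite m) (hsph : ∀ p (s : ℝ), 0 < s → m (sphere p s) = 0) {x y : X}
    {δ R C : ℝ} (hC : 0 ≤ C) (hDef : DeformIneq m E y R C) (hδR : δ < R)
    (hdisj : Disjoint (closedBall x δ) (closedBall y δ)) {r V' D : ℝ} (hr : 0 < r) (hrδ : r < δ)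
    (hwr : m (ball y r \ E) ≤ m (ball x r ∩ E)) (hwδ : m (ball x r ∩ E) < m (ball y δ \ E))
    (hV : HasDerivAt (fun t => (m (ball x t ∩ E)).toReal) V' r) (hD0 : 0 ≤ D) (hD : V' < D) :
    Per m (E ∩ ball x r) Set.univ ≤
      ENNReal.ofReal (C * (m (ball x r ∩ E)).toReal / r + 3 * D) := by
  have hfin : m (ball x r ∩ E) ≠ ∞ :=
    measure_ne_top_of_subset inter_subset_left (hbf _ isBounded_ball).ne
  have hcont : ContinuousOn (fun s => m (ball y s \ E)) (Icc r δ) :=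
    (continuousOn_measure_ball_inter hbf y (hsph y) hE.1.compl).mono
      fun s hs => hr.trans_le hs.1
  obtain ⟨s, hs, hsr⟩ := intermediate_value_Icc hrδ.le hcont ⟨hwr, hwδ.le⟩
  have hsδ : s < δ := hs.2.lt_of_ne fun h => by
    subst h
    exact hwδ.ne' hsr
  have hs0 : 0 < s := hr.trans_le hs.1
  obtain ⟨h1, h2⟩ := eventually_measure_annulus_le hbf hsph x hE.1 hr hV hD
  refine (hE.per_inter_ball_le hsph hDef hδR hdisj hr hrδ hs0 hsδ hsr.symm h1 h2).trans ?_
  simp only at hsr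
  rw [hsr, add_assoc, ← ENNReal.ofReal_add hD0 (by positivity),
    ENNReal.ofReal_add (p := C * (m (ball x r ∩ E)).toReal / r) (by positivity) (by positivity)]
  refine add_le_add ?_ (ENNReal.ofReal_le_ofReal (by linarith))
  rw [ENNReal.ofReal_div_of_pos hr, ENNReal.ofReal_mul hC, ENNReal.ofReal_toReal hfin]
  exact ENNReal.div_le_div_left (ENNReal.ofReal_le_ofReal hs.1) _

/-- Differential inequality for the volume of a volume-constrained minimizer in small balls around
a point of density zero. -/
lemma VolConstMin.eventually_le_mul_deriv_rpow [ProperSpace X] {E : Set X} (hE : VolConstMin m E)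
    (hbf : BoundedlyFinite m) {C_D : ℝ → ℝ} (hd : UnifLocDoublingWith C_D m)
    (hC2 : ∀ R, 2 ≤ C_D R) {lam : ℝ} {C_P : ℝ → ℝ} (hlam : 1 ≤ lam)
    (hP : WeakPoincareWith lam C_P m) (hCP : 0 < C_P 1)
    (hpos : ∀ p (t : ℝ), 0 < t → m (ball p t) ≠ 0)
    (hsph : ∀ p (s : ℝ), 0 < s → m (sphere p s) = 0) {x y : X} (hx : x ∈ essExt m E)
    {δ R C : ℝ} (hC : 0 ≤ C) (hDef : DeformIneq m E y R C) (hδ0 : 0 < δ) (hδR : δ < R)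
    (hdisj : Disjoint (closedBall x δ) (closedBall y δ)) (hwδ : 0 < m (ball y δ \ E))
    (hv : ∀ r : ℝ, 0 < r → 0 < m (ball x r ∩ E)) :
    ∃ θ > (0 : ℝ), ∃ c > (0 : ℝ), ∀ᶠ r in 𝓝[>] (0 : ℝ),
      m (ball y r \ E) ≤ m (ball x r ∩ E) →
      DifferentiableAt ℝ (fun t => (m (ball x t ∩ E)).toReal) r →
      c * (m (ball x r)).toReal ^ θ ≤ r * deriv (fun t => (m (ball x t ∩ E)).toReal ^ θ) r := by
  obtain ⟨R', -, A, hA, hiso⟩ := exists_isoperimetric hbf hd hlam hP hCP hpos hsph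
  set K := C_D R'
  have hK : 2 ≤ K := hC2 R'
  have hK0 : 0 < K := by linarith
  set θ := Real.log 2 / Real.log K
  have hlogK : 0 < Real.log K := Real.log_pos (by linarith)
  have hθ : 0 < θ := div_pos (Real.log_pos one_lt_two) hlogK
  have hKθ : K ^ θ = 2 := by
    rw [Real.rpow_def_of_pos hK0, mul_div_cancel₀ _ hlogK.ne', Real.exp_log two_pos]
  set V : ℝ → ℝ := fun t => (m (ball x t ∩ E)).toReal with hVdef
  set M : ℝ → ℝ := fun t => (m (ball x t)).toReal with hMdef
  have hbt : ∀ p (t : ℝ), m (ball p t) ≠ ∞ := fun p t => (hbf _ isBounded_ball).ne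
  have hvt : ∀ t : ℝ, m (ball x t ∩ E) ≠ ∞ := fun t =>
    measure_ne_top_of_subset inter_subset_left (hbt x t)
  set B := 6 * A * (2 * K ^ 2) ^ θ
  have hB : 0 < B := by positivity
  have hq : Tendsto (fun r => V r / M r) (𝓝[>] 0) (𝓝 0) := tendsto_toReal_div_of_mem_essExt hx
  have e1 : ∀ᶠ r in 𝓝[>] (0 : ℝ), A * C * (2 * K ^ 2 * (V r / M r)) ^ θ < 1 / 2 := by
    have : Tendsto (fun q : ℝ => A * C * (2 * K ^ 2 * q) ^ θ) (𝓝 0) (𝓝 0) := by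
      have hc : Continuous fun q : ℝ => A * C * (2 * K ^ 2 * q) ^ θ :=
        continuous_const.mul ((continuous_const_mul _).rpow_const fun _ => Or.inr hθ.le)
      simpa [Real.zero_rpow hθ.ne'] using hc.tendsto 0
    exact (this.comp hq).eventually (gt_mem_nhds one_half_pos)
  have e2 : ∀ᶠ r in 𝓝[>] (0 : ℝ), K * 2 * (V r / M r) < 1 := by
    have := hq.const_mul (K * 2)
    rw [mul_zero] at this
    exact this.eventually (gt_mem_nhds one_pos)
  have e3 : ∀ᶠ r in 𝓝[>] (0 : ℝ), V r / M r * M δ < (m (ball y δ \ E)).toReal := by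
    have := hq.mul_const (M δ)
    rw [zero_mul] at this
    exact this.eventually (gt_mem_nhds (ENNReal.toReal_pos hwδ.ne'
      (measure_ne_top_of_subset sdiff_subset (hbt y δ))))
  refine ⟨θ, hθ, θ / B, div_pos hθ hB, ?_⟩
  filter_upwards [e1, e2, e3, Ioo_mem_nhdsGT hδ0, Ioo_mem_nhdsGT one_pos] with r h1 h2 h3 h4 h5
    hwr hdiff
  have hr := h4.1
  have hM0 : 0 < M r := ENNReal.toReal_pos (hpos x r hr) (hbt x r)
  have hV0 : 0 < V r := ENNReal.toReal_pos (hv r hr).ne' (hvt r)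
  set q := 2 * K ^ 2 * (V r / M r) with hqdef
  have hq0 : 0 < q := by positivity
  set V' := deriv V r
  have hder : HasDerivAt V V' r := hdiff.hasDerivAt
  have hV'0 : 0 ≤ V' := (monotone_measureReal_ball_inter hbf x E).deriv_nonneg
  have hvlt : m (ball x r ∩ E) < m (ball y δ \ E) := by
    rw [← ENNReal.toReal_lt_toReal (hvt r) (measure_ne_top_of_subset sdiff_subset (hbt y δ))]
    refine lt_of_le_of_lt ?_ h3
    rw [div_mul_eq_mul_div, le_div_iff₀ hM0]
    exact mul_le_mul_of_nonneg_left (ENNReal.toReal_mono (hbt x δ)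
      (measure_mono (ball_subset_ball h4.2.le))) hV0.le
  have hmG : m (E ∩ ball x r) = ENNReal.ofReal (V r) := by
    rw [inter_comm, ENNReal.ofReal_toReal (hvt r)]
  have hmB : m (ball x r) = ENNReal.ofReal (M r) := (ENNReal.ofReal_toReal (hbt x r)).symm
  have hiso' := hiso x r (E ∩ ball x r) hr h5.2 (hE.1.inter isOpen_ball.measurableSet)
    inter_subset_right (by
      rw [hmG, hmB, ← ENNReal.ofReal_ofNat 2, ← ENNReal.ofReal_mul two_pos.le,
        ← ENNReal.ofReal_mul hK0.le, ENNReal.ofReal_lt_ofReal_iff hM0]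
      rw [← mul_div_assoc, div_lt_one hM0] at h2
      linarith) (r * q ^ θ) (by positivity) (by
      intro j hj
      rw [hmG, hmB, ← ENNReal.ofReal_ofNat 2, ← ENNReal.ofReal_mul two_pos.le,
        ← ENNReal.ofReal_pow hK0.le, ← ENNReal.ofReal_mul (by positivity),
        ENNReal.ofReal_le_ofReal_iff (by positivity)] at hj
      have hj2 : (K ^ j)⁻¹ ≤ q := by
        rw [inv_le_iff_one_le_mul₀ (by positivity), hqdef, ← mul_div_assoc, div_mul_eq_mul_div,
          le_div_iff₀ hM0]
        calc 1 * M r ≤ K ^ (j + 2) * (2 * V r) := by rwa [one_mul]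
          _ = _ := by ring
      rw [div_eq_mul_inv]
      refine mul_le_mul_of_nonneg_left ?_ hr.le
      calc ((2 : ℝ) ^ j)⁻¹ = ((K ^ j)⁻¹) ^ θ := by
            rw [Real.inv_rpow (by positivity), ← Real.rpow_natCast K j, ← Real.rpow_mul hK0.le,
              mul_comm, Real.rpow_mul hK0.le, hKθ, Real.rpow_natCast]
        _ ≤ q ^ θ := Real.rpow_le_rpow (by positivity) hj2 hθ.le)
  have hall : ∀ D, V' < D → V r ≤ A * (r * q ^ θ) * (C * V r / r + 3 * D) := by
    intro D hD
    have hD0 : 0 ≤ D := hV'0.trans hD.le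
    have hper := hE.per_inter_ball_le_deriv hbf hsph hC hDef hδR hdisj hr h4.2 hwr hvlt hder hD0 hD
    have := hiso'.trans (mul_le_mul_right hper _)
    rwa [hmG, ← ENNReal.ofReal_mul (by positivity), ENNReal.ofReal_le_ofReal_iff (by positivity)]
      at this
  have hlim : V r ≤ A * (r * q ^ θ) * (C * V r / r + 3 * V') := by
    have hc : Continuous fun D : ℝ => A * (r * q ^ θ) * (C * V r / r + 3 * D) := by fun_prop
    refine ge_of_tendsto ((hc.tendsto V').mono_left (nhdsWithin_le_nhds (s := Ioi V'))) ?_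
    filter_upwards [self_mem_nhdsWithin] with D hD using hall D hD
  have hmain : V r ≤ 6 * A * (r * q ^ θ) * V' := by
    have h6 : A * (r * q ^ θ) * (C * V r / r + 3 * V') =
        A * C * q ^ θ * V r + 3 * A * (r * q ^ θ) * V' := by
      field_simp
    rw [h6] at hlim
    nlinarith
  have hqθ : q ^ θ * M r ^ θ = (2 * K ^ 2) ^ θ * V r ^ θ := by
    rw [← Real.mul_rpow hq0.le hM0.le, ← Real.mul_rpow (by positivity) hV0.le, hqdef, mul_assoc,
      div_mul_cancel₀ _ hM0.ne']
  have hfinal : M r ^ θ * V r ≤ B * (r * V' * V r ^ θ) := by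
    calc M r ^ θ * V r ≤ M r ^ θ * (6 * A * (r * q ^ θ) * V') := by gcongr
      _ = 6 * A * r * V' * (q ^ θ * M r ^ θ) := by ring
      _ = _ := by rw [hqθ]; ring
  rw [(hder.rpow_const (p := θ) (Or.inl hV0.ne')).deriv, Real.rpow_sub_one hV0.ne',
    div_mul_eq_mul_div, div_le_iff₀ hB]
  calc θ * M r ^ θ = θ * (M r ^ θ * V r) / V r := by field_simp
    _ ≤ θ * (B * (r * V' * V r ^ θ)) / V r := by gcongr
    _ = _ := by ring

end VolumeGrowth

/-- **Key lemma** (Lemma 3.6): under hypotheses (i) and (ii), the point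
`x ∈ E^{(0)}` belongs to the topological interior of `E^{(0)}`. -/
theorem key_lemma
    {X : Type*} [MetricSpace X] [CompleteSpace X] [TopologicalSpace.SeparableSpace X]
    [MeasurableSpace X] [BorelSpace X] (m : Measure X)
    (hbf : BoundedlyFinite m) (hPI : IsPIspace m) (hlen : IsLengthSpace X)
    (hdef : DeformationProperty m) (E : Set X) (hE : VolConstMin m E)
    (x y : X) (hx : x ∈ essExt m E) (hy : y ∈ essInt m E)
    (v w : ℝ → ℝ≥0∞)
    (hv : ∀ r : ℝ, v r = m (Metric.ball x r ∩ E))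
    (hw : ∀ r : ℝ, w r = m (Metric.ball y r \ E))
    (rs : ℕ → ℝ) (hrs : ∀ n, rs n ∈ Set.Ioo (0:ℝ) 1) (hrs0 : Tendsto rs atTop (𝓝 0))
    (A : ℕ → Set ℝ) (hA : ∀ n, A n = { r ∈ Set.Ioo 0 (rs n) | w r ≤ v r })
    (δ : ℝ) (hδ0 : 0 < δ) (hδR : δ < deformRadius m E y)
    (hdisj : Disjoint (Metric.closedBall x δ) (Metric.closedBall y δ))
    (hvδ : 0 < v δ) (hwδ : 0 < w δ)
    (hfreq : ∃ᶠ n in atTop, ENNReal.ofReal (rs n / 2) ≤ volume (A n)) :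
    x ∈ interior (essExt m E) := by
  by_contra hcon
  obtain rfl : v = fun r => m (ball x r ∩ E) := funext hv
  obtain rfl : w = fun r => m (ball y r \ E) := funext hw
  simp only at hA hvδ hwδ
  have hv0 : ∀ r : ℝ, 0 < r → 0 < m (ball x r ∩ E) := fun r hr => pos_iff_ne_zero.2 fun h =>
    hcon (mem_interior_essExt_of_measure_inter_eq_zero hr h)
  obtain ⟨⟨C_D', -, hd'⟩, lam, hlam, C_P, hCP, hP⟩ := hPI
  obtain ⟨C_D, hC2, hd⟩ : ∃ C_D : ℝ → ℝ, (∀ R, 2 ≤ C_D R) ∧ UnifLocDoublingWith C_D m :=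
    ⟨fun R => max (C_D' R) 2, fun R => le_max_right _ _, fun R hR p t ht htR =>
      (hd' R hR p t ht htR).trans
        (mul_le_mul_left (ENNReal.ofReal_le_ofReal (le_max_left _ _)) _)⟩
  have : ProperSpace X := properSpace_of_doubling hbf hd hvδ.ne'
  have : SecondCountableTopology X := UniformSpace.secondCountable_of_separable X
  have hpos : ∀ p (t : ℝ), 0 < t → m (ball p t) ≠ 0 := fun p t ht =>
    (hd.measure_ball_pos hvδ.ne' p ht).ne'
  have hsph : ∀ p (s : ℝ), 0 < s → m (sphere p s) = 0 := fun p s hs =>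
    measure_sphere_eq_zero hbf hd hlen p hs
  obtain ⟨R, ⟨-, -, C, hC, hDef⟩, hR⟩ := exists_lt_of_lt_csSup (hdef E hE.1 hE.2.1 y) hδR
  obtain ⟨θ, hθ, c, hc, hev⟩ := hE.eventually_le_mul_deriv_rpow hbf hd hC2 hlam hP
    (hCP 1 one_pos) hpos hsph hx hC hDef hδ0 hR hdisj hwδ hv0
  obtain ⟨r₀, hr₀, hsub⟩ := mem_nhdsGT_iff_exists_Ioo_subset.1 hev
  set K := C_D 4
  have hK0 : 0 < K := two_pos.trans_le (hC2 4)
  have hbt : ∀ t : ℝ, m (ball x t) ≠ ∞ := fun t => (hbf _ isBounded_ball).ne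
  have hmono := monotone_measureReal_ball_inter hbf x E
  have hrs' : Tendsto rs atTop (𝓝[>] 0) :=
    tendsto_nhdsWithin_iff.2 ⟨hrs0, Eventually.of_forall fun n => (hrs n).1⟩
  set a := c / (4 * (K ^ 2) ^ θ) with ha_def
  have ha : 0 < a := by positivity
  have hsmall : Tendsto (fun r : ℝ => ((m (ball x r ∩ E)).toReal / (m (ball x r)).toReal) ^ θ)
      (𝓝[>] 0) (𝓝 0) := by
    simpa [Real.zero_rpow hθ.ne'] using
      (tendsto_toReal_div_of_mem_essExt hx).rpow_const (Or.inr hθ.le)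
  obtain ⟨n, hn, hnr, hna⟩ := (hfreq.and_eventually ((hrs0.eventually (gt_mem_nhds hr₀)).and
    ((hsmall.comp hrs').eventually (gt_mem_nhds ha)))).exists
  simp only [Function.comp_apply] at hna
  set ρ := rs n
  have hρ : 0 < ρ := (hrs n).1
  have hρ1 : ρ < 1 := (hrs n).2
  have hM0 : 0 < (m (ball x ρ)).toReal := ENNReal.toReal_pos (hpos x ρ hρ) (hbt ρ)
  have hvol : ENNReal.ofReal (ρ / 4) ≤ volume (A n ∩ Ioc (ρ / 4) ρ) := by
    have hcover : A n ⊆ A n ∩ Ioc (ρ / 4) ρ ∪ Ioc 0 (ρ / 4) := by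
      intro t ht
      have ht' := (hA n ▸ ht).1
      rcases le_or_gt t (ρ / 4) with h | h
      · exact Or.inr ⟨ht'.1, h⟩
      · exact Or.inl ⟨ht, h, ht'.2.le⟩
    have h1 := hn.trans ((measure_mono hcover).trans (measure_union_le _ _))
    rw [Real.volume_Ioc, sub_zero, show ρ / 2 = ρ / 4 + ρ / 4 by ring,
      ENNReal.ofReal_add (by positivity) (by positivity)] at h1
    exact (ENNReal.add_le_add_iff_right ENNReal.ofReal_ne_top).1 h1
  have hfmono : Monotone fun t => (m (ball x t ∩ E)).toReal ^ θ := fun s t hst =>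
    Real.rpow_le_rpow ENNReal.toReal_nonneg (hmono hst) hθ.le
  set β := c * ((m (ball x ρ)).toReal / K ^ 2) ^ θ / ρ with hβ
  have hderiv : ∀ᵐ t, t ∈ A n ∩ Ioc (ρ / 4) ρ →
      β ≤ deriv (fun t => (m (ball x t ∩ E)).toReal ^ θ) t := by
    filter_upwards [hmono.ae_differentiableAt] with t ht hts
    obtain ⟨⟨ht0, htρ⟩, hwt⟩ := hA n ▸ hts.1
    have h1 := hsub ⟨ht0, htρ.trans hnr⟩ hwt ht
    have hdbl : (m (ball x ρ)).toReal / K ^ 2 ≤ (m (ball x t)).toReal := by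
      have h3 := hd.iterate (R := 4) x ht0 2 (by linarith)
      have h4 := (measure_mono (ball_subset_ball
        (show ρ ≤ 2 ^ 2 * t by linarith [hts.2.1]))).trans h3
      have h5 := ENNReal.toReal_mono (ENNReal.mul_ne_top (by finiteness) (hbt t)) h4
      rw [ENNReal.toReal_mul, ENNReal.toReal_pow, ENNReal.toReal_ofReal hK0.le] at h5
      rwa [div_le_iff₀' (by positivity)]
    rw [hβ, div_le_iff₀ hρ, mul_comm _ ρ]
    calc c * ((m (ball x ρ)).toReal / K ^ 2) ^ θ ≤ c * (m (ball x t)).toReal ^ θ := by gcongr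
      _ ≤ _ := h1
      _ ≤ _ := mul_le_mul_of_nonneg_right htρ.le hfmono.deriv_nonneg
  have h1 := hfmono.ofReal_mul_volume_le (show ρ / 4 ≤ ρ by linarith) inter_subset_right hderiv
  have h2 := (mul_le_mul_right hvol _).trans h1
  have hβ0 : 0 ≤ β := by positivity
  rw [← ENNReal.ofReal_mul hβ0] at h2
  have h3 : β * (ρ / 4) ≤ (m (ball x ρ ∩ E)).toReal ^ θ := by
    rcases le_or_gt (β * (ρ / 4)) 0 with h | h
    · exact h.trans (by positivity)
    · refine (ENNReal.ofReal_le_ofReal_iff'.1 h2).elim (fun h' => h'.trans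
        (sub_le_self _ (by positivity))) fun h' => absurd h' h.not_ge
  rw [Real.div_rpow ENNReal.toReal_nonneg hM0.le, div_lt_iff₀ (by positivity)] at hna
  refine (h3.trans_lt hna).ne ?_
  rw [hβ, ha_def, Real.div_rpow hM0.le (by positivity)]
  field_simp

end
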